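/- arXiv:2312.16841 — 5 statements merged into one kernel-verified Lean document; each statement's English description precedes it below -/
import Mathlib

section
/- Let D be a weighted oriented graph having at most two unbalanced cycles such that (i) if D has exactly two unbalanced cycles connected by a path P, then no balanced cycle in D shares an edge with P, and (ii) no two balanced cycles in D share a path. Let b_D denote the number of balanced cycles in D. Then the toric ideal I_D is a complete intersection ideal, and its minimal number of generators is μ(I_D) = b_D + 1 if D has two unbalanced cycles sharing a vertex or two unbalanced cycles connected by a path, and μ(I_D) = b_D otherwise. -/
open MvPolynomial Finset

/-- The "positive part" `∏ e, X e ^ (b e)⁺` of the binomial associated to an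
integer vector `b`. -/
noncomputable def binomPlus (K : Type*) [Field K] {ι : Type*} [Fintype ι]
    (b : ι → ℤ) : MvPolynomial ι K :=
  ∏ e, X e ^ (b e).toNat

/-- The "negative part" `∏ e, X e ^ (b e)⁻` of the binomial associated to an
integer vector `b`. -/
noncomputable def binomMinus (K : Type*) [Field K] {ι : Type*} [Fintype ι]
    (b : ι → ℤ) : MvPolynomial ι K :=
  ∏ e, X e ^ (-b e).toNat

/-- The (pure) binomial `f_b = f_b⁺ - f_b⁻` associated to an integer vector `b`. -/
noncomputable def binom (K : Type*) [Field K] {ι : Type*} [Fintype ι]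
    (b : ι → ℤ) : MvPolynomial ι K :=
  binomPlus K b - binomMinus K b

/-- Support of an integer vector. -/
def vsupp {ι : Type*} (b : ι → ℤ) : Set ι := {e | b e ≠ 0}

/-- `f_b` is a primitive binomial of the ideal `I`. -/
def IsPrimitiveIn (K : Type*) [Field K] {ι : Type*} [Fintype ι]
    (I : Ideal (MvPolynomial ι K)) (b : ι → ℤ) : Prop :=
  b ≠ 0 ∧ binom K b ∈ I ∧
    ∀ c : ι → ℤ, c ≠ 0 → binom K c ∈ I →
      binomPlus K c ∣ binomPlus K b → binomMinus K c ∣ binomMinus K b → c = b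

/-- A (vertex-)weighted oriented graph: finite sets of vertices and edges, each
edge `e` oriented from `src e` to `tgt e`, no loops, no parallel edges, and a
positive integer weight attached to every vertex. -/
structure WOGraph (V E : Type*) where
  src : E → V
  tgt : E → V
  w : V → ℕ
  no_loop : ∀ e, src e ≠ tgt e
  no_parallel : ∀ e e' : E, s(src e, tgt e) = s(src e', tgt e') → e = e'
  wpos : ∀ v, 0 < w v

namespace WOGraph

variable {V E : Type*}

/-- The toric ideal `I_D` of a weighted oriented graph: the kernel of
`K[e : e ∈ E(D)] → K[x : x ∈ V(D)]`, `e = (x_i,x_j) ↦ x_i x_j ^ w_j`. -/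
noncomputable def toricIdeal (D : WOGraph V E) (K : Type*) [Field K] :
    Ideal (MvPolynomial E K) :=
  RingHom.ker (aeval (R := K)
    (fun e => X (D.src e) * X (D.tgt e) ^ D.w (D.tgt e)) :
      MvPolynomial E K →ₐ[K] MvPolynomial V K).toRingHom

/-- The edge `e` is incident with the vertex `v`. -/
def incident (D : WOGraph V E) (v : V) (e : E) : Prop :=
  D.src e = v ∨ D.tgt e = v

/-- Degree of a vertex. -/
noncomputable def degree (D : WOGraph V E) (v : V) : ℕ :=
  Set.ncard {e : E | D.incident v e}

/-- A leaf is a vertex of degree 1. -/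
def IsLeaf (D : WOGraph V E) (v : V) : Prop := D.degree v = 1

/-- A sink is a vertex of outdegree 0. -/
def IsSink (D : WOGraph V E) (v : V) : Prop := ∀ e, D.src e ≠ v

/-- The Graver basis `Gr_D`: the set of primitive binomials of `I_D`. -/
def graverSet (D : WOGraph V E) (K : Type*) [Field K] [Fintype E] :
    Set (MvPolynomial E K) :=
  {f | ∃ b : E → ℤ, f = binom K b ∧ IsPrimitiveIn K (D.toricIdeal K) b}

/-- The set `C_D` of circuits of `I_D`: irreducible binomials of `I_D` with
minimal support. -/
def circuitSet (D : WOGraph V E) (K : Type*) [Field K] [Fintype E] :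
    Set (MvPolynomial E K) :=
  {f | ∃ b : E → ℤ, f = binom K b ∧ b ≠ 0 ∧ binom K b ∈ D.toricIdeal K ∧
      (Finset.univ.gcd fun e => (b e).natAbs) = 1 ∧
      ∀ c : E → ℤ, c ≠ 0 → binom K c ∈ D.toricIdeal K →
        vsupp c ⊆ vsupp b → vsupp c = vsupp b}

/-- Cyclic successor on `Fin n`. -/
def finRot {n : ℕ} (i : Fin n) : Fin n := ⟨((i : ℕ) + 1) % n, Nat.mod_lt _ i.pos⟩

/-- A cycle of length `n ≥ 3` in a weighted oriented graph `D`, with its usual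
labelling: the edge `edge i` joins the vertices `vert i` and `vert (i+1)`
(indices cyclically). -/
structure CycleIn (D : WOGraph V E) where
  n : ℕ
  hn : 3 ≤ n
  vert : Fin n → V
  edge : Fin n → E
  vinj : Function.Injective vert
  einj : Function.Injective edge
  hinc : ∀ i : Fin n, s(D.src (edge i), D.tgt (edge i)) = s(vert i, vert (finRot i))

/-- A path of length `k ≥ 1` in `D`, with its usual labelling: the edge `edge i`
joins `vert i` and `vert (i+1)`. -/
structure PathIn (D : WOGraph V E) where
  k : ℕ
  hk : 1 ≤ k
  vert : Fin (k + 1) → V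
  edge : Fin k → E
  vinj : Function.Injective vert
  einj : Function.Injective edge
  hinc : ∀ i : Fin k, s(D.src (edge i), D.tgt (edge i)) = s(vert i.castSucc, vert i.succ)

variable [DecidableEq V]

/-- The incidence entry of a vertex `v` and an edge `e`: `1` if `e` leaves `v`,
`w v` if `e` enters `v`, `0` otherwise. -/
def inc (D : WOGraph V E) (v : V) (e : E) : ℤ :=
  if D.src e = v then 1 else if D.tgt e = v then (D.w v : ℤ) else 0

/-- The incidence matrix of a cycle in `D` (with respect to its usual labelling). -/
def CycleIn.mat {D : WOGraph V E} (C : CycleIn D) : Matrix (Fin C.n) (Fin C.n) ℤ :=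
  fun i j => D.inc (C.vert i) (C.edge j)

/-- A cycle is balanced if its incidence matrix is singular. -/
def CycleIn.IsBalanced {D : WOGraph V E} (C : CycleIn D) : Prop := C.mat.det = 0

/-- A cycle is unbalanced if its incidence matrix is nonsingular. -/
def CycleIn.IsUnbalanced {D : WOGraph V E} (C : CycleIn D) : Prop := C.mat.det ≠ 0

end WOGraph

namespace WOGraph

variable {V E : Type*}

/-- Two cycles share exactly one vertex. -/
def ShareOneVertex {D : WOGraph V E} (C₁ C₂ : CycleIn D) : Prop :=
  (∃ v : V, Set.range C₁.vert ∩ Set.range C₂.vert = {v}) ∧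
    Set.range C₁.edge ∩ Set.range C₂.edge = ∅

/-- Two cycles share the path `P`. -/
def SharePath {D : WOGraph V E} (C₁ C₂ : CycleIn D) (P : PathIn D) : Prop :=
  Set.range P.edge ⊆ Set.range C₁.edge ∧ Set.range P.edge ⊆ Set.range C₂.edge ∧
    Set.range C₁.edge ∩ Set.range C₂.edge = Set.range P.edge ∧
    Set.range C₁.vert ∩ Set.range C₂.vert = Set.range P.vert

/-- Two (disjoint) cycles are connected by the path `P`, which meets `C₁` only in
its first vertex and `C₂` only in its last vertex. -/
def ConnectedByPath {D : WOGraph V E} (C₁ C₂ : CycleIn D) (P : PathIn D) : Prop :=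
  Set.range C₁.vert ∩ Set.range C₂.vert = ∅ ∧
    P.vert 0 ∈ Set.range C₁.vert ∧ P.vert (Fin.last P.k) ∈ Set.range C₂.vert ∧
    (∀ i : Fin (P.k + 1), i ≠ 0 → P.vert i ∉ Set.range C₁.vert) ∧
    (∀ i : Fin (P.k + 1), i ≠ Fin.last P.k → P.vert i ∉ Set.range C₂.vert) ∧
    Set.range P.edge ∩ (Set.range C₁.edge ∪ Set.range C₂.edge) = ∅

/-- `f` is the primitive binomial generator of the (principal) toric ideal of the
subgraph of `D` with edge set `S` (identified with the binomials of `I_D`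
supported in `S`). -/
def IsPrimGenOn (D : WOGraph V E) (K : Type*) [Field K] [Fintype E]
    (S : Set E) (f : MvPolynomial E K) : Prop :=
  ∃ b : E → ℤ, f = binom K b ∧ b ≠ 0 ∧ vsupp b ⊆ S ∧ binom K b ∈ D.toricIdeal K ∧
    (∀ c : E → ℤ, c ≠ 0 → vsupp c ⊆ S → binom K c ∈ D.toricIdeal K →
      binomPlus K c ∣ binomPlus K b → binomMinus K c ∣ binomMinus K b → c = b) ∧
    (∀ g : MvPolynomial E K, g ∈ D.toricIdeal K →
      (∀ m ∈ g.support, ∀ e : E, m e ≠ 0 → e ∈ S) → g ∈ Ideal.span {f})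

end WOGraph

section LatticeIdeal

variable {E τ ι : Type*} [Fintype E] (K : Type*) [Field K]

/-- The exponent vector of the positive part of `b`. -/
noncomputable def posExp (b : E → ℤ) : E →₀ ℕ :=
  Finsupp.equivFunOnFinite.symm fun e => (b e).toNat

@[simp] lemma posExp_apply (b : E → ℤ) (e : E) : posExp b e = (b e).toNat := rfl

lemma binom_eq_monomial (b : E → ℤ) :
    binom K b = monomial (posExp b) 1 - monomial (posExp (-b)) 1 := by
  have h (c : E → ℤ) : ∏ e, (X e : MvPolynomial E K) ^ (c e).toNat = monomial (posExp c) 1 := by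
    rw [monomial_eq, map_one, one_mul, Finsupp.prod_fintype _ _ (by simp)]
    rfl
  rw [← h, ← h]
  rfl

/-- The monomial map `e ↦ x ^ (a e)`. -/
noncomputable def monomialMap (a : E → τ →₀ ℕ) : MvPolynomial E K →ₐ[K] MvPolynomial τ K :=
  aeval fun e => monomial (a e) 1

omit [Fintype E] in
lemma monomialMap_monomial (a : E → τ →₀ ℕ) (u : E →₀ ℕ) (c : K) :
    monomialMap K a (monomial u c) = monomial (Finsupp.linearCombination ℕ a u) c := by
  simp only [monomialMap, aeval_monomial, monomial_pow, one_pow, Finsupp.linearCombination_apply]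
  rw [monomial_finsupp_sum_index]
  rfl

variable {K}

lemma monomial_sub_mem {b : ι → E → ℤ} [Fintype ι] (hdis : ∀ i j e, i ≠ j → b i e = 0 ∨ b j e = 0)
    {J : Ideal (MvPolynomial E K)} {n : ι → ℤ} (hJ : ∀ i, n i ≠ 0 → binom K (b i) ∈ J)
    {u v : E →₀ ℕ} (huv : ∀ e, (u e : ℤ) - v e = ∑ i, n i * b i e) :
    monomial u 1 - monomial v 1 ∈ J := by
  classical
  induction hN : ∑ i, (n i).natAbs using Nat.strong_induction_on generalizing n u v with
  | _ N ih =>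
  by_cases h0 : ∀ i, n i = 0
  · have : u = v := by
      ext e
      have := huv e
      simp only [h0, zero_mul, sum_const_zero] at this
      omega
    simp [this]
  push Not at h0
  obtain ⟨i, hi⟩ := h0
  wlog hpos : 0 < n i generalizing n u v
  · have := this (n := -n) (u := v) (v := u) (fun i hi => hJ i (by simpa using hi))
      (fun e => by
        have := huv e
        simp only [Pi.neg_apply, neg_mul, sum_neg_distrib]
        omega) (by simpa using hN) (by simpa using hi) (by simp; omega)
    rw [← neg_sub]
    exact J.neg_mem this
  have hloc : ∀ e, b i e ≠ 0 → (u e : ℤ) - v e = n i * b i e := fun e he => by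
    rw [huv e]
    refine Finset.sum_eq_single i (fun j _ hj => ?_) (by simp)
    rw [(hdis j i e hj).resolve_right he, mul_zero]
  have hnonneg : ∀ e, 0 ≤ (v e : ℤ) + b i e := fun e => by
    by_cases he : b i e = 0
    · simp [he]
    · have := hloc e he
      rcases lt_or_gt_of_ne he with h | h
      · nlinarith [Int.natCast_nonneg (u e)]
      · positivity
  set w : E →₀ ℕ := v - posExp (-(b i)) with hw
  have hv : v = w + posExp (-(b i)) := by
    ext e
    have := hnonneg e
    simp [hw]
    omega
  have h1 : monomial u 1 - monomial (w + posExp (b i)) 1 ∈ J := by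
    have hsum : ∑ j, (Function.update n i (n i - 1) j).natAbs < N := by
      rw [← hN]
      refine Finset.sum_lt_sum (fun j _ => ?_) ⟨i, mem_univ _, ?_⟩
      · by_cases hj : j = i
        · subst hj; simp; omega
        · simp [hj]
      · simp; omega
    refine ih _ hsum (n := Function.update n i (n i - 1)) (fun j hj => ?_) (fun e => ?_) rfl
    · by_cases hji : j = i
      · subst hji; exact hJ _ hi
      · exact hJ j (by simpa [hji] using hj)
    · have h2 : ∑ j, Function.update n i (n i - 1) j * b j e = ∑ j, n j * b j e - b i e := by
        rw [eq_sub_iff_add_eq, ← Finset.add_sum_erase _ _ (mem_univ i),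
          ← Finset.add_sum_erase _ (fun j => n j * b j e) (mem_univ i)]
        have : ∑ x ∈ univ.erase i, Function.update n i (n i - 1) x * b x e =
            ∑ x ∈ univ.erase i, n x * b x e :=
          Finset.sum_congr rfl fun j hj => by simp [(Finset.mem_erase.1 hj).1]
        rw [this]
        simp
        ring
      rw [h2, ← huv e]
      have := hnonneg e
      simp [hw]
      omega
  have h2 : monomial (w + posExp (b i)) 1 - monomial v 1 ∈ J := by
    have : (monomial (w + posExp (b i)) 1 - monomial v 1 : MvPolynomial E K) =
        monomial w 1 * binom K (b i) := by
      rw [binom_eq_monomial, mul_sub, monomial_mul, monomial_mul, ← hv, one_mul]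
    rw [this]
    exact J.mul_mem_left _ (hJ i hi)
  simpa using J.add_mem h1 h2

omit [Fintype E] in
lemma ker_monomialMap_le {a : E → τ →₀ ℕ} {J : Ideal (MvPolynomial E K)}
    (h : ∀ u v : E →₀ ℕ, Finsupp.linearCombination ℕ a u = Finsupp.linearCombination ℕ a v →
      monomial u 1 - monomial v 1 ∈ J) : RingHom.ker (monomialMap K a) ≤ J := by
  classical
  let rep : (τ →₀ ℕ) → (E →₀ ℕ) := Function.invFun (Finsupp.linearCombination ℕ a)
  let s : MvPolynomial τ K →ₗ[K] MvPolynomial E K ⧸ J :=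
    (basisMonomials τ K).constr K fun α => Ideal.Quotient.mk J (monomial (rep α) 1)
  have hs : s ∘ₗ (monomialMap K a).toLinearMap = (Ideal.Quotient.mkₐ K J).toLinearMap := by
    refine (basisMonomials E K).ext fun u => ?_
    have h1 : s (monomial (Finsupp.linearCombination ℕ a u) 1) =
        Ideal.Quotient.mk J (monomial (rep (Finsupp.linearCombination ℕ a u)) 1) := by
      have := (basisMonomials τ K).constr_basis K
        (fun α => Ideal.Quotient.mk J (monomial (rep α) 1)) (Finsupp.linearCombination ℕ a u)
      simpa using this
    simp only [coe_basisMonomials, LinearMap.comp_apply, AlgHom.toLinearMap_apply,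
      monomialMap_monomial, h1, Ideal.Quotient.mkₐ_eq_mk]
    exact Ideal.Quotient.eq.2 (h _ _ (Function.invFun_eq ⟨u, rfl⟩))
  intro f hf
  have := LinearMap.congr_fun hs f
  simp only [LinearMap.comp_apply, AlgHom.toLinearMap_apply, Ideal.Quotient.mkₐ_eq_mk] at this
  rw [RingHom.mem_ker] at hf
  rw [show (monomialMap K a) f = 0 from hf, map_zero] at this
  exact Ideal.Quotient.eq_zero_iff_mem.1 this.symm

lemma linearCombination_nat_apply (a : E → τ →₀ ℕ) (u : E →₀ ℕ) (t : τ) :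
    Finsupp.linearCombination ℕ a u t = ∑ e, u e * a e t := by
  rw [Finsupp.linearCombination_apply, Finsupp.sum_fintype _ _ (by simp), Finsupp.finsetSum_apply]
  rfl

/-- The data of a lattice basis with pairwise disjoint supports for the exponent map `a`, each
basis vector having entries of both signs. -/
structure IsDisjointBasis [Fintype ι] (a : E → τ →₀ ℕ) (b : ι → E → ℤ) : Prop where
  disj : ∀ i j e, i ≠ j → b i e = 0 ∨ b j e = 0
  pos : ∀ i, ∃ e, 0 < b i e
  neg : ∀ i, ∃ e, b i e < 0
  ker : ∀ i t, ∑ e, b i e * a e t = 0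
  gen : ∀ c : E → ℤ, (∀ t, ∑ e, c e * a e t = 0) → ∃ n : ι → ℤ, ∀ e, c e = ∑ i, n i * b i e

namespace IsDisjointBasis

variable [Fintype ι] {a : E → τ →₀ ℕ} {b : ι → E → ℤ}

/-- The exponent map `a` extended by the coordinates in `S`. -/
noncomputable def extend (a : E → τ →₀ ℕ) (S : Set E) (e : E) : τ ⊕ E →₀ ℕ :=
  open Classical in
  (a e).embDomain .inl + if e ∈ S then Finsupp.single (.inr e) 1 else 0

omit [Fintype E] in
lemma extend_inl (S : Set E) (e : E) (t : τ) : extend a S e (.inl t) = a e t := by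
  have : (a e).embDomain Function.Embedding.inl (.inl t : τ ⊕ E) = a e t :=
    Finsupp.embDomain_apply_self ..
  rw [extend, Finsupp.add_apply, this]
  split_ifs <;> simp

omit [Fintype E] in
open Classical in
lemma extend_inr (S : Set E) (e e' : E) :
    extend a S e (.inr e') = if e ∈ S ∧ e' = e then 1 else 0 := by
  have : (a e).embDomain Function.Embedding.inl (.inr e' : τ ⊕ E) = 0 :=
    Finsupp.embDomain_of_notMem_range _ _ _ (by simp)
  rw [extend, Finsupp.add_apply, this]
  by_cases h : e ∈ S <;> simp [h, Finsupp.single_apply, eq_comm]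

open Classical in
lemma linearCombination_extend_inr (S : Set E) (u : E →₀ ℕ) (e : E) :
    Finsupp.linearCombination ℕ (extend a S) u (.inr e) = if e ∈ S then u e else 0 := by
  rw [linearCombination_nat_apply, Finset.sum_eq_single e]
  · simp [extend_inr]
  · intro e' _ h
    simp [extend_inr, h.symm]
  · simp

lemma linearCombination_extend_inl (S : Set E) (u : E →₀ ℕ) (t : τ) :
    Finsupp.linearCombination ℕ (extend a S) u (.inl t) = Finsupp.linearCombination ℕ a u t := by
  simp [linearCombination_nat_apply, extend_inl]

lemma sub_eq (hb : IsDisjointBasis a b) {u v : E →₀ ℕ}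
    (h : Finsupp.linearCombination ℕ a u = Finsupp.linearCombination ℕ a v) :
    ∃ n : ι → ℤ, ∀ e, (u e : ℤ) - v e = ∑ i, n i * b i e := by
  refine hb.gen _ fun t => ?_
  have := DFunLike.congr_fun h t
  simp only [linearCombination_nat_apply] at this
  simp only [sub_mul, sum_sub_distrib, sub_eq_zero]
  exact_mod_cast this

lemma linearCombination_posExp (hb : IsDisjointBasis a b) (i : ι) :
    Finsupp.linearCombination ℕ a (posExp (b i)) =
      Finsupp.linearCombination ℕ a (posExp (-(b i))) := by
  ext t
  have := hb.ker i t
  simp only [linearCombination_nat_apply, posExp_apply, Pi.neg_apply]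
  zify
  rw [← sub_eq_zero, ← sum_sub_distrib, ← this]
  refine Finset.sum_congr rfl fun e _ => ?_
  rw [← sub_mul]
  congr 1
  omega

variable (K)

lemma ker_eq_span (hb : IsDisjointBasis a b) :
    RingHom.ker (monomialMap K a) = Ideal.span (Set.range fun i => binom K (b i)) := by
  refine le_antisymm (ker_monomialMap_le fun u v huv => ?_) (Ideal.span_le.2 ?_)
  · obtain ⟨n, hn⟩ := hb.sub_eq huv
    exact monomial_sub_mem hb.disj (fun i _ => Ideal.subset_span (Set.mem_range_self i)) hn
  · rintro _ ⟨i, rfl⟩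
    simp only [SetLike.mem_coe, RingHom.mem_ker, binom_eq_monomial, map_sub]
    rw [monomialMap_monomial, monomialMap_monomial, hb.linearCombination_posExp, sub_self]

/-- The edges on which some basis vector outside `T` is supported. -/
def outside (b : ι → E → ℤ) (T : Set ι) : Set E := {e | ∃ j ∉ T, b j e ≠ 0}

lemma span_image_eq_ker (hb : IsDisjointBasis a b) (T : Set ι) :
    Ideal.span ((fun i => binom K (b i)) '' T) =
      RingHom.ker (monomialMap K (extend a (outside b T))) := by
  classical
  refine le_antisymm (Ideal.span_le.2 ?_) (ker_monomialMap_le fun u v huv => ?_)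
  · rintro _ ⟨i, hi, rfl⟩
    simp only [SetLike.mem_coe, RingHom.mem_ker, binom_eq_monomial, map_sub]
    rw [monomialMap_monomial, monomialMap_monomial, sub_eq_zero]
    refine congrArg (fun x => monomial x (1 : K)) (Finsupp.ext fun t => ?_)
    rcases t with t | e
    · rw [linearCombination_extend_inl, linearCombination_extend_inl, hb.linearCombination_posExp]
    · rw [linearCombination_extend_inr, linearCombination_extend_inr]
      split_ifs with he
      · obtain ⟨j, hj, hje⟩ := he
        have : b i e = 0 := (hb.disj i j e (by rintro rfl; exact hj hi)).resolve_right hje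
        simp [this]
      · rfl
  · have h1 : Finsupp.linearCombination ℕ a u = Finsupp.linearCombination ℕ a v := by
      ext t
      rw [← linearCombination_extend_inl (outside b T), huv, linearCombination_extend_inl]
    obtain ⟨n, hn⟩ := hb.sub_eq h1
    refine monomial_sub_mem hb.disj
      (fun i hi => Ideal.subset_span (Set.mem_image_of_mem (fun i => binom K (b i)) ?_)) hn
    by_contra hiT
    obtain ⟨e, he⟩ := hb.pos i
    have h2 := DFunLike.congr_fun huv (.inr e)
    have he' : e ∈ outside b T := ⟨i, hiT, he.ne'⟩
    rw [linearCombination_extend_inr, linearCombination_extend_inr, if_pos he', if_pos he'] at h2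
    have h3 := hn e
    rw [Finset.sum_eq_single i (fun j _ hj => by
      rw [(hb.disj j i e hj).resolve_right he.ne', mul_zero]) (by simp), h2, sub_self] at h3
    exact mul_ne_zero hi he.ne' h3.symm

lemma isPrime_span_image (hb : IsDisjointBasis a b) (T : Set ι) :
    (Ideal.span ((fun i => binom K (b i)) '' T)).IsPrime := by
  rw [hb.span_image_eq_ker K]
  exact RingHom.ker_isPrime _

lemma binom_notMem_span_image (hb : IsDisjointBasis a b) {T : Set ι} {j : ι} (hj : j ∉ T) :
    binom K (b j) ∉ Ideal.span ((fun i => binom K (b i)) '' T) := by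
  classical
  rw [hb.span_image_eq_ker K, RingHom.mem_ker, binom_eq_monomial, map_sub]
  rw [monomialMap_monomial, monomialMap_monomial, sub_eq_zero]
  intro h
  obtain ⟨e, he⟩ := hb.pos j
  have h2 := DFunLike.congr_fun ((monomial_left_injective one_ne_zero) h) (.inr e)
  have he' : e ∈ outside b T := ⟨j, hj, he.ne'⟩
  rw [linearCombination_extend_inr, linearCombination_extend_inr, if_pos he', if_pos he'] at h2
  simp at h2
  omega

lemma injective_binom (hb : IsDisjointBasis a b) : Function.Injective fun i => binom K (b i) := by
  intro i j hij
  by_contra hne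
  refine hb.binom_notMem_span_image K (T := {j}) (j := i) hne ?_
  rw [Set.image_singleton, show binom K (b i) = binom K (b j) from hij]
  exact Ideal.subset_span rfl

lemma exists_isRegular (hb : IsDisjointBasis a b) :
    ∃ L : List (MvPolynomial E K), RingTheory.Sequence.IsRegular (MvPolynomial E K) L ∧
      Ideal.span {x | x ∈ L} = RingHom.ker (monomialMap K a) := by
  classical
  let l : List ι := univ.toList
  have hl : l.Nodup := Finset.nodup_toList _
  have hspan : ∀ l' : List ι, Ideal.ofList (l'.map fun i => binom K (b i)) =
      Ideal.span ((fun i => binom K (b i)) '' {i | i ∈ l'}) := fun l' => by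
    rw [Ideal.ofList]
    congr 1
    ext x
    simp
  have hmem : {i | i ∈ l} = Set.univ := by ext; simp [l]
  refine ⟨l.map fun i => binom K (b i), ⟨⟨fun k hk => ?_⟩, ?_⟩, ?_⟩
  · rw [← List.map_take, hspan, smul_eq_mul, Ideal.mul_top]
    have hk' : k < l.length := by simpa using hk
    have hprime := hb.isPrime_span_image K {i | i ∈ l.take k}
    have hnot : binom K (b l[k]) ∉
        Ideal.span ((fun i => binom K (b i)) '' {i | i ∈ l.take k}) := by
      refine hb.binom_notMem_span_image K fun h => ?_
      obtain ⟨m, hm, hmk⟩ := List.mem_iff_getElem.1 h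
      rw [List.getElem_take] at hmk
      have := (hl.getElem_inj_iff).1 hmk
      simp at hm
      omega
    rw [isSMulRegular_iff_right_eq_zero_of_smul]
    intro x hx
    obtain ⟨x, rfl⟩ := Ideal.Quotient.mk_surjective x
    rw [List.getElem_map] at hx
    have hx' : binom K (b l[k]) * x ∈
        Ideal.span ((fun i => binom K (b i)) '' {i | i ∈ l.take k}) :=
      Ideal.Quotient.eq_zero_iff_mem.1 hx
    exact Ideal.Quotient.eq_zero_iff_mem.2 ((hprime.mem_or_mem hx').resolve_left hnot)
  · rw [hspan, smul_eq_mul, Ideal.mul_top]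
    exact (hb.isPrime_span_image K _).ne_top.symm
  · rw [hb.ker_eq_span K, ← Set.image_univ, ← hmem, ← hspan]

variable {K}

lemma coeff_eq_zero (hb : IsDisjointBasis a b) {g : MvPolynomial E K}
    (hg : g ∈ RingHom.ker (monomialMap K a)) (i : ι) {m : E →₀ ℕ}
    (hm : m < posExp (b i)) : coeff m g = 0 := by
  classical
  rw [hb.ker_eq_span K] at hg
  induction hg using Submodule.span_induction generalizing m with
  | mem x hx =>
    obtain ⟨j, rfl⟩ := hx
    have h1 : posExp (b j) ≠ m := by
      rintro rfl
      by_cases hij : j = i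
      · subst hij; exact hm.ne rfl
      · obtain ⟨e, he⟩ := hb.pos j
        have h0 := (hb.disj j i e hij).resolve_left he.ne'
        have := hm.le e
        simp only [posExp_apply] at this
        omega
    have h2 : posExp (-(b j)) ≠ m := by
      rintro rfl
      obtain ⟨e, he⟩ := hb.neg j
      have := hm.le e
      simp only [posExp_apply, Pi.neg_apply] at this
      by_cases hij : j = i
      · subst hij; omega
      · have h0 := (hb.disj j i e hij).resolve_left he.ne
        omega
    simp only [binom_eq_monomial, coeff_sub, coeff_monomial, if_neg h1, if_neg h2, sub_zero]
  | zero => simp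
  | add x y _ _ hx hy => rw [coeff_add, hx hm, hy hm, add_zero]
  | smul x y _ hy =>
    rw [smul_eq_mul, coeff_mul]
    refine Finset.sum_eq_zero fun p hp => ?_
    rw [hy (lt_of_le_of_lt ?_ hm), mul_zero]
    rw [← HasAntidiagonal.mem_antidiagonal.1 hp]
    exact le_add_self

lemma coeff_mul_posExp (hb : IsDisjointBasis a b) {g : MvPolynomial E K}
    (hg : g ∈ RingHom.ker (monomialMap K a)) (p : MvPolynomial E K) (i : ι) :
    coeff (posExp (b i)) (p * g) = coeff 0 p * coeff (posExp (b i)) g := by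
  classical
  rw [coeff_mul, Finset.sum_eq_single (0, posExp (b i))]
  · rintro ⟨x, y⟩ hxy hne
    rw [HasAntidiagonal.mem_antidiagonal] at hxy
    rw [hb.coeff_eq_zero hg i (m := y), mul_zero]
    refine lt_of_le_of_ne (by rw [← hxy]; exact le_add_self) ?_
    rintro rfl
    exact hne (by simpa using hxy)
  · simp

lemma coeff_posExp_binom [DecidableEq ι] (hb : IsDisjointBasis a b) (i j : ι) :
    coeff (posExp (b i)) (binom K (b j)) = if j = i then 1 else 0 := by
  classical
  obtain ⟨e, he⟩ := hb.pos i
  obtain ⟨e', he'⟩ := hb.neg j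
  have h2 : posExp (-(b j)) ≠ posExp (b i) := by
    intro h
    have := DFunLike.congr_fun h e'
    simp only [posExp_apply, Pi.neg_apply] at this
    by_cases hij : j = i
    · subst hij; omega
    · have h0 := (hb.disj j i e' hij).resolve_left he'.ne
      omega
  rw [binom_eq_monomial, coeff_sub, coeff_monomial, coeff_monomial, if_neg h2, sub_zero]
  by_cases hij : j = i
  · simp [hij]
  · rw [if_neg, if_neg hij]
    intro h
    have := DFunLike.congr_fun h e
    have h0 := (hb.disj j i e hij).resolve_right he.ne'
    simp [h0] at this
    omega

lemma card_le_of_span_eq (hb : IsDisjointBasis a b) (S : Finset (MvPolynomial E K))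
    (hS : Ideal.span (S : Set (MvPolynomial E K)) = RingHom.ker (monomialMap K a)) :
    Fintype.card ι ≤ S.card := by
  classical
  let lam : MvPolynomial E K →ₗ[K] (ι → K) := LinearMap.pi fun i => lcoeff K (posExp (b i))
  have hlam : ∀ f i, lam f i = coeff (posExp (b i)) f := fun _ _ => rfl
  have hmem : ∀ f ∈ Ideal.span (S : Set (MvPolynomial E K)),
      lam f ∈ Submodule.span K (lam '' (S : Set (MvPolynomial E K))) := by
    intro f hf
    induction hf using Submodule.span_induction with
    | mem x hx => exact Submodule.subset_span ⟨x, hx, rfl⟩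
    | zero => simp
    | add x y _ _ hx hy => rw [map_add]; exact add_mem hx hy
    | smul p x hx ih =>
      have : lam (p • x) = coeff 0 p • lam x := by
        ext i
        rw [smul_eq_mul, hlam, Pi.smul_apply, hlam, smul_eq_mul]
        exact hb.coeff_mul_posExp (by rw [← hS]; exact hx) p i
      rw [this]
      exact Submodule.smul_mem _ _ ih
  have htop : Submodule.span K (lam '' (S : Set (MvPolynomial E K))) = ⊤ := by
    rw [eq_top_iff, ← (Pi.basisFun K ι).span_eq, Submodule.span_le]
    rintro _ ⟨j, rfl⟩
    have h1 : lam (binom K (b j)) = Pi.basisFun K ι j := by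
      ext i
      rw [hlam, hb.coeff_posExp_binom, Pi.basisFun_apply, Pi.single_apply]
      simp only [eq_comm]
    rw [← h1]
    refine hmem _ ?_
    rw [hS, hb.ker_eq_span K]
    exact Ideal.subset_span ⟨j, rfl⟩
  have h2 := finrank_span_finset_le_card (R := K) (S.image lam)
  rw [Finset.coe_image, Set.finrank, htop, finrank_top, Module.finrank_fintype_fun_eq_card] at h2
  exact h2.trans Finset.card_image_le

variable (K)

lemma isLeast_card (hb : IsDisjointBasis a b) :
    IsLeast {r : ℕ | ∃ S : Finset (MvPolynomial E K), S.card = r ∧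
      Ideal.span (S : Set (MvPolynomial E K)) = RingHom.ker (monomialMap K a)}
      (Fintype.card ι) := by
  classical
  refine ⟨⟨univ.image fun i => binom K (b i), ?_, ?_⟩, ?_⟩
  · rw [Finset.card_image_of_injective _ (hb.injective_binom K), card_univ]
  · rw [hb.ker_eq_span K]
    congr 1
    simp
  · rintro _ ⟨S, rfl, hS⟩
    exact hb.card_le_of_span_eq S hS

end IsDisjointBasis

end LatticeIdeal

section DisjointCircuits

variable {E τ : Type*} [Fintype E]

/-- `c` is an integer relation between the exponent vectors `a e`. -/
def IsRelation (a : E → τ →₀ ℕ) (c : E → ℤ) : Prop := ∀ t, ∑ e, c e * a e t = 0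

lemma IsRelation.sub_smul {a : E → τ →₀ ℕ} {c d : E → ℤ} (hc : IsRelation a c)
    (hd : IsRelation a d) (r s : ℤ) : IsRelation a fun e => r * c e - s * d e := fun t => by
  simp only [sub_mul, sum_sub_distrib, mul_assoc, ← Finset.mul_sum, hc t, hd t]
  simp

lemma IsRelation.exists_pos {a : E → τ →₀ ℕ} (ha : ∀ e, a e ≠ 0) {c : E → ℤ}
    (hc : IsRelation a c) (h0 : c ≠ 0) : ∃ e, 0 < c e := by
  by_contra! h
  obtain ⟨e, he⟩ := Function.ne_iff.1 h0
  obtain ⟨t, ht⟩ := DFunLike.ne_iff.1 (ha e)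
  have := (Finset.sum_eq_zero_iff_of_nonpos fun e' _ =>
    mul_nonpos_of_nonpos_of_nonneg (h e') (Int.natCast_nonneg (a e' t))).1 (hc t) e (mem_univ e)
  rcases mul_eq_zero.1 this with h | h
  · exact he h
  · exact ht (by exact_mod_cast h)

lemma IsRelation.neg {a : E → τ →₀ ℕ} {c : E → ℤ} (hc : IsRelation a c) : IsRelation a (-c) :=
  fun t => by simpa using hc t

/-- If `b` has gcd `1` and `b e` divides every multiple `x * b f`, then `b e` divides `x`. -/
lemma exists_mul_eq_of_gcd_eq_one {b : E → ℤ} (hb : univ.gcd b = 1) {x : ℤ} {e : E}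
    (h : ∀ f, b e ∣ x * b f) : ∃ t, x = b e * t := by
  have : b e ∣ univ.gcd fun f => x * b f := Finset.dvd_gcd fun f _ => h f
  rw [Finset.gcd_mul_left, hb, mul_one] at this
  exact (dvd_normalize_iff.1 this)

lemma exists_isDisjointBasis {a : E → τ →₀ ℕ} (ha : ∀ e, a e ≠ 0) (𝒮 : Set (Set E)) [Fintype 𝒮]
    (hdis : ∀ S ∈ 𝒮, ∀ T ∈ 𝒮, S ≠ T → Disjoint S T) (hne : ∀ S ∈ 𝒮, S.Nonempty)
    (hex : ∀ S ∈ 𝒮, ∃ c ≠ 0, IsRelation a c ∧ vsupp c ⊆ S)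
    (hsub : ∀ c ≠ 0, IsRelation a c → ∃ S ∈ 𝒮, S ⊆ vsupp c) :
    ∃ b : 𝒮 → E → ℤ, IsDisjointBasis a b := by
  classical
  have key : ∀ S : 𝒮, ∃ b : E → ℤ, IsRelation a b ∧ vsupp b = S ∧ univ.gcd b = 1 := by
    rintro ⟨S, hS⟩
    obtain ⟨c, hc0, hc, hcS⟩ := hex S hS
    obtain ⟨T, hT, hTc⟩ := hsub c hc0 hc
    have hTS : T = S := by
      by_contra hne'
      obtain ⟨e, he⟩ := hne T hT
      exact Set.disjoint_left.1 (hdis T hT S hS hne') he (hcS (hTc he))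
    subst hTS
    obtain ⟨e, he⟩ := hne T hS
    obtain ⟨b, hb, hgcd⟩ := Finset.extract_gcd c (s := univ) ⟨e, mem_univ e⟩
    have hg : univ.gcd c ≠ 0 := fun h => hc0 (by
      ext e
      simpa [h] using hb e (mem_univ e))
    refine ⟨b, fun t => ?_, ?_, hgcd⟩
    · have := hc t
      simp only [fun e => hb e (mem_univ e), mul_assoc, ← Finset.mul_sum] at this
      exact (mul_eq_zero.1 this).resolve_left hg
    · refine Set.Subset.antisymm (fun e he => hcS ?_) fun e he => ?_
      · have : c e ≠ 0 := by rw [hb e (mem_univ e)]; exact mul_ne_zero hg he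
        exact this
      · have : c e ≠ 0 := hTc he
        rw [hb e (mem_univ e)] at this
        exact right_ne_zero_of_mul this
  choose b hrel hsupp hgcd using key
  have hmem : ∀ S e, b S e ≠ 0 ↔ e ∈ S.1 := fun S e => by rw [← hsupp S]; rfl
  have hne0 : ∀ S, b S ≠ 0 := fun S h => by
    obtain ⟨e, he⟩ := hne S.1 S.2
    exact (hmem S e).2 he (by simp [h])
  have hdisj : ∀ i j e, i ≠ j → b i e = 0 ∨ b j e = 0 := by
    intro i j e hij
    by_contra! h
    exact Set.disjoint_left.1 (hdis i.1 i.2 j.1 j.2 (fun h => hij (Subtype.ext h)))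
      ((hmem i e).1 h.1) ((hmem j e).1 h.2)
  refine ⟨b, hdisj, fun i => (hrel i).exists_pos ha (hne0 i), fun i => ?_, hrel, fun c hc => ?_⟩
  · obtain ⟨e, he⟩ := (hrel i).neg.exists_pos ha (neg_ne_zero.2 (hne0 i))
    exact ⟨e, by simpa using he⟩
  · have hc : IsRelation a c := hc
    induction hN : (vsupp c).ncard using Nat.strong_induction_on generalizing c with
    | _ N ih =>
    by_cases hc0 : c = 0
    · exact ⟨0, by simp [hc0]⟩
    obtain ⟨S, hS, hSc⟩ := hsub c hc0 hc
    obtain ⟨e, he⟩ := hne S hS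
    have hce : c e ≠ 0 := hSc he
    set B := b ⟨S, hS⟩ with hB
    have hBe : B e ≠ 0 := (hmem ⟨S, hS⟩ e).2 he
    have hred : ∀ r s : ℤ, r * c e = s * B e →
        ∃ n : 𝒮 → ℤ, ∀ f, r * c f - s * B f = ∑ i, n i * b i f := fun r s hrs => by
      refine ih _ ?_ _ (hc.sub_smul (hrel _) r s) (hc.sub_smul (hrel _) r s) rfl
      rw [← hN]
      refine Set.ncard_lt_ncard ⟨fun f hf => ?_, fun h => ?_⟩ (Set.toFinite _)
      · by_contra hcf
        have hcf : c f = 0 := by simpa [vsupp] using hcf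
        have hBf : B f = 0 := by
          by_contra hBf
          exact hSc ((hmem ⟨S, hS⟩ f).1 hBf) hcf
        exact hf (by simp [hcf, hBf])
      · exact h (show e ∈ vsupp c from hce) (by simp [hrs])
    obtain ⟨n, hn⟩ := hred (B e) (c e) (mul_comm _ _)
    have hsum : ∀ f ∈ S, ∑ i, n i * b i f = n ⟨S, hS⟩ * B f := fun f hf => by
      refine Finset.sum_eq_single _ (fun j _ hj => ?_) (by simp)
      rw [(hdisj j _ f hj).resolve_right ((hmem ⟨S, hS⟩ f).2 hf), mul_zero]
    have hn0 : n ⟨S, hS⟩ = 0 := by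
      have := hn e
      rw [hsum e he, mul_comm, sub_self] at this
      exact (mul_eq_zero.1 this.symm).resolve_right hBe
    obtain ⟨t, ht⟩ := exists_mul_eq_of_gcd_eq_one (hgcd ⟨S, hS⟩) (x := c e) (e := e) fun f => by
      by_cases hf : f ∈ S
      · have := hn f
        rw [hsum f hf, hn0, zero_mul, sub_eq_zero] at this
        exact ⟨c f, this.symm⟩
      · have : b ⟨S, hS⟩ f = 0 := by
          by_contra h
          exact hf ((hmem _ f).1 h)
        simp [this]
    obtain ⟨m, hm⟩ := hred 1 t (by rw [one_mul, ht, mul_comm])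
    refine ⟨fun i => m i + if i = ⟨S, hS⟩ then t else 0, fun f => ?_⟩
    have := hm f
    simp only [add_mul, sum_add_distrib, ← this, ite_mul, zero_mul, sum_ite_eq', mem_univ, if_true]
    ring

end DisjointCircuits

namespace WOGraph

open SimpleGraph

variable {V E : Type*} (D : WOGraph V E)

/-- The underlying unordered pair of an edge. -/
def ends (e : E) : Sym2 V := s(D.src e, D.tgt e)

lemma ends_injective : Function.Injective D.ends := fun e e' h => D.no_parallel e e' h

/-- The simple graph underlying the subgraph of `D` with edge set `S`. -/
def graph (S : Set E) : SimpleGraph V where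
  Adj u v := ∃ e ∈ S, D.ends e = s(u, v)
  symm := ⟨fun u v ⟨e, he, h⟩ => ⟨e, he, h.trans Sym2.eq_swap⟩⟩
  loopless := ⟨fun v ⟨e, _, h⟩ => D.no_loop e (by
    have h' : s(D.src e, D.tgt e) = s(v, v) := h
    simp only [Sym2.eq_iff] at h'
    rcases h' with ⟨h1, h2⟩ | ⟨h1, h2⟩ <;> rw [h1, h2])⟩

variable {D}

lemma graph_mono {S T : Set E} (h : S ⊆ T) : D.graph S ≤ D.graph T :=
  fun _ _ ⟨e, he, h'⟩ => ⟨e, h he, h'⟩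

/-- The edges of `D` traversed by a walk. -/
def edgeSetOf {S : Set E} {u v : V} (p : (D.graph S).Walk u v) : Set E := {e | D.ends e ∈ p.edges}

section Walks

variable {S : Set E} {u v w : V}

lemma mem_edgeSetOf {p : (D.graph S).Walk u v} {e : E} :
    e ∈ edgeSetOf p ↔ D.ends e ∈ p.edges := Iff.rfl

lemma exists_of_mem_edges {p : (D.graph S).Walk u v} {x : Sym2 V} (h : x ∈ p.edges) :
    ∃ e ∈ S, D.ends e = x ∧ e ∈ edgeSetOf p := by
  induction x with
  | _ a b =>
    obtain ⟨e, he, h'⟩ := p.adj_of_mem_edges h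
    exact ⟨e, he, h', by rw [mem_edgeSetOf, h']; exact h⟩

lemma edgeSetOf_subset (p : (D.graph S).Walk u v) : edgeSetOf p ⊆ S := fun e he => by
  obtain ⟨e', he', h, -⟩ := exists_of_mem_edges he
  rwa [← D.ends_injective h]

@[simp] lemma edgeSetOf_append (p : (D.graph S).Walk u v) (q : (D.graph S).Walk v w) :
    edgeSetOf (p.append q) = edgeSetOf p ∪ edgeSetOf q := by
  ext e; simp [mem_edgeSetOf]

@[simp] lemma edgeSetOf_reverse (p : (D.graph S).Walk u v) :
    edgeSetOf p.reverse = edgeSetOf p := by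
  ext e; simp [mem_edgeSetOf]

lemma edgeSetOf_cons {h : (D.graph S).Adj u v} (p : (D.graph S).Walk v w) {f : E}
    (hf : D.ends f = s(u, v)) : edgeSetOf (p.cons h) = insert f (edgeSetOf p) := by
  ext e
  rw [mem_edgeSetOf, Walk.edges_cons, List.mem_cons, ← hf, Set.mem_insert_iff, mem_edgeSetOf,
    D.ends_injective.eq_iff]

lemma edgeSetOf_mapLe {T : Set E} (h : S ⊆ T) (p : (D.graph S).Walk u v) :
    edgeSetOf (p.mapLe (graph_mono h)) = edgeSetOf p := by
  ext e; simp [mem_edgeSetOf]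

lemma edgeSetOf_nonempty {p : (D.graph S).Walk u v} (h : u ≠ v) : (edgeSetOf p).Nonempty := by
  cases p with
  | nil => exact absurd rfl h
  | @cons _ w _ h' q =>
    obtain ⟨e, -, -, he⟩ := exists_of_mem_edges (p := q.cons h') (x := s(u, w)) (by simp)
    exact ⟨e, he⟩

lemma src_mem_support {p : (D.graph S).Walk u v} {e : E} (h : e ∈ edgeSetOf p) :
    D.src e ∈ p.support := p.fst_mem_support_of_mem_edges h

lemma tgt_mem_support {p : (D.graph S).Walk u v} {e : E} (h : e ∈ edgeSetOf p) :
    D.tgt e ∈ p.support := p.snd_mem_support_of_mem_edges h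

lemma mem_edges_iff_getVert {G : SimpleGraph V} {p : G.Walk u v} {x : Sym2 V} :
    x ∈ p.edges ↔ ∃ i < p.length, x = s(p.getVert i, p.getVert (i + 1)) := by
  induction p with
  | nil => simp
  | cons h q ih =>
    rw [Walk.edges_cons, List.mem_cons, ih]
    constructor
    · rintro (rfl | ⟨i, hi, rfl⟩)
      · exact ⟨0, by simp, by simp⟩
      · exact ⟨i + 1, by simpa using hi, by simp⟩
    · rintro ⟨i, hi, rfl⟩
      cases i with
      | zero => left; simp
      | succ i => right; exact ⟨i, by simpa using hi, by simp⟩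

lemma exists_edge_getVert (p : (D.graph S).Walk u v) {i : ℕ} (hi : i < p.length) :
    ∃ e, D.ends e = s(p.getVert i, p.getVert (i + 1)) := by
  obtain ⟨e, -, he⟩ := p.adj_getVert_succ hi
  exact ⟨e, he⟩

lemma exists_pathIn {p : (D.graph S).Walk u v} (hp : p.IsPath) (huv : u ≠ v) :
    ∃ P : PathIn D, Set.range P.edge = edgeSetOf p ∧ Set.range P.vert = {x | x ∈ p.support} ∧
      P.vert 0 = u ∧ P.vert (Fin.last P.k) = v := by
  choose g hg using fun i : Fin p.length => exists_edge_getVert p i.2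
  have hinj := hp.getVert_injOn
  have hlen : 1 ≤ p.length := by
    by_contra! h
    exact huv (Walk.eq_of_length_eq_zero (p := p) (by omega))
  refine ⟨⟨p.length, hlen, fun i => p.getVert i, g, fun i j hij => ?_, fun i j hij => ?_,
    fun i => hg i⟩, ?_, ?_, ?_, ?_⟩
  · exact Fin.ext (hinj (show (i : ℕ) ≤ _ by omega) (show (j : ℕ) ≤ _ by omega) hij)
  · have h : s(p.getVert i, p.getVert (i + 1)) = s(p.getVert j, p.getVert (j + 1)) := by
      rw [← hg, ← hg, hij]
    have h1 := i.2
    have h2 := j.2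
    rcases Sym2.eq_iff.1 h with ⟨h3, -⟩ | ⟨h3, h4⟩
    · exact Fin.ext (hinj h1.le h2.le h3)
    · have := hinj h1.le (show (j : ℕ) + 1 ≤ _ by omega) h3
      have := hinj (show (i : ℕ) + 1 ≤ _ by omega) h2.le h4
      omega
  · ext e
    rw [mem_edgeSetOf, mem_edges_iff_getVert]
    constructor
    · rintro ⟨i, rfl⟩
      exact ⟨i, i.2, hg i⟩
    · rintro ⟨i, hi, he⟩
      exact ⟨⟨i, hi⟩, D.ends_injective ((hg ⟨i, hi⟩).trans he.symm)⟩
  · ext x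
    rw [Set.mem_ofPred_eq, Walk.mem_support_iff_exists_getVert]
    constructor
    · rintro ⟨i, rfl⟩
      exact ⟨i, rfl, Nat.le_of_lt_succ i.2⟩
    · rintro ⟨i, rfl, hi⟩
      exact ⟨⟨i, Nat.lt_succ_of_le hi⟩, rfl⟩
  · simp
  · simp

lemma exists_cycleIn {c : (D.graph S).Walk u u} (hc : c.IsCycle) :
    ∃ C : CycleIn D, Set.range C.edge = edgeSetOf c ∧ Set.range C.vert = {x | x ∈ c.support} := by
  choose g hg using fun i : Fin c.length => exists_edge_getVert c i.2
  have hlen : 3 ≤ c.length := hc.three_le_length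
  have hinj := hc.getVert_injOn'
  have hrot : ∀ i : Fin c.length, c.getVert (finRot i) = c.getVert (i + 1) := fun i => by
    rcases Nat.lt_or_ge (i + 1) c.length with h | h
    · simp [finRot, Nat.mod_eq_of_lt h]
    · have : (i : ℕ) + 1 = c.length := by omega
      simp [finRot, this]
  have hinj2 := hc.getVert_injOn
  refine ⟨⟨c.length, hlen, fun i => c.getVert i, g, fun i j hij => ?_, fun i j hij => ?_,
    fun i => (hg i).trans (by rw [hrot])⟩, ?_, ?_⟩
  · exact Fin.ext (hinj (show (i : ℕ) ≤ _ by omega) (show (j : ℕ) ≤ _ by omega) hij)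
  · have h : s(c.getVert i, c.getVert (i + 1)) = s(c.getVert j, c.getVert (j + 1)) := by
      rw [← hg, ← hg, hij]
    have h1 := i.2
    have h2 := j.2
    rcases Sym2.eq_iff.1 h with ⟨h3, -⟩ | ⟨h3, h4⟩
    · exact Fin.ext (hinj (show (i : ℕ) ≤ _ by omega) (show (j : ℕ) ≤ _ by omega) h3)
    · rcases Nat.eq_zero_or_pos (i : ℕ) with hi | hi
      · rcases Nat.eq_zero_or_pos (j : ℕ) with hj | hj
        · exact Fin.ext (by omega)
        · have := hinj2 (show 1 ≤ (i : ℕ) + 1 ∧ (i : ℕ) + 1 ≤ _ by omega)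
            (show 1 ≤ (j : ℕ) ∧ (j : ℕ) ≤ _ by omega) h4
          rw [hi, Walk.getVert_zero, eq_comm, hc.getVert_endpoint_iff (by omega)] at h3
          omega
      · have := hinj2 (show 1 ≤ (i : ℕ) ∧ (i : ℕ) ≤ _ by omega)
            (show 1 ≤ (j : ℕ) + 1 ∧ (j : ℕ) + 1 ≤ _ by omega) h3
        rcases Nat.eq_zero_or_pos (j : ℕ) with hj | hj
        · rw [hj, Walk.getVert_zero, hc.getVert_endpoint_iff (by omega)] at h4
          omega
        · have := hinj2 (show 1 ≤ (i : ℕ) + 1 ∧ (i : ℕ) + 1 ≤ _ by omega)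
            (show 1 ≤ (j : ℕ) ∧ (j : ℕ) ≤ _ by omega) h4
          omega
  · ext e
    rw [mem_edgeSetOf, mem_edges_iff_getVert]
    constructor
    · rintro ⟨i, rfl⟩
      exact ⟨i, i.2, hg i⟩
    · rintro ⟨i, hi, he⟩
      exact ⟨⟨i, hi⟩, D.ends_injective ((hg ⟨i, hi⟩).trans he.symm)⟩
  · ext x
    rw [Set.mem_ofPred_eq, Walk.mem_support_iff_exists_getVert]
    constructor
    · rintro ⟨i, rfl⟩
      exact ⟨i, rfl, i.2.le⟩
    · rintro ⟨i, rfl, hi⟩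
      rcases hi.lt_or_eq with h | h
      · exact ⟨⟨i, h⟩, rfl⟩
      · refine ⟨⟨0, show 0 < c.length by omega⟩, ?_⟩
        simp [h]

/-- A sequence of consecutively adjacent vertices is traversed by a walk. -/
lemma exists_walk_getVert {G : SimpleGraph V} (f : ℕ → V) (k : ℕ)
    (h : ∀ i < k, G.Adj (f i) (f (i + 1))) :
    ∃ p : G.Walk (f 0) (f k), p.length = k ∧ ∀ i ≤ k, p.getVert i = f i := by
  induction k generalizing f with
  | zero => exact ⟨.nil, rfl, fun i hi => by simp [Nat.le_zero.1 hi]⟩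
  | succ k ih =>
    obtain ⟨p, hp, hv⟩ := ih (fun i => f (i + 1)) fun i hi => h (i + 1) (by omega)
    refine ⟨p.cons (h 0 (by omega)), by simp [hp], fun i hi => ?_⟩
    cases i with
    | zero => simp
    | succ i => simpa using hv i (by omega)

lemma PathIn.exists_walk (P : PathIn D) :
    ∃ p : (D.graph Set.univ).Walk (P.vert 0) (P.vert (Fin.last P.k)),
      p.IsPath ∧ edgeSetOf p = Set.range P.edge := by
  let f : ℕ → V := fun i => P.vert (Fin.ofNat (P.k + 1) i)
  have hf : ∀ i (hi : i < P.k), D.ends (P.edge ⟨i, hi⟩) = s(f i, f (i + 1)) := fun i hi => by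
    have h1 : Fin.ofNat (P.k + 1) i = (⟨i, hi⟩ : Fin P.k).castSucc :=
      Fin.ext (by simp; omega)
    have h2 : Fin.ofNat (P.k + 1) (i + 1) = (⟨i, hi⟩ : Fin P.k).succ :=
      Fin.ext (by simp; omega)
    simp only [f, h1, h2]
    exact P.hinc ⟨i, hi⟩
  obtain ⟨p, hp, hv⟩ := exists_walk_getVert (G := D.graph Set.univ) f P.k
    fun i hi => ⟨P.edge ⟨i, hi⟩, trivial, hf i hi⟩
  have h0 : f 0 = P.vert 0 := by simp [f]
  have hk : f P.k = P.vert (Fin.last P.k) :=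
    congrArg P.vert (Fin.ext (by simp))
  refine ⟨p.copy h0 hk, ?_, ?_⟩
  · rw [Walk.isPath_copy, ← Walk.IsPath.getVert_injOn_iff]
    intro i hi j hj hij
    have hi' : i ≤ P.k := hp ▸ hi
    have hj' : j ≤ P.k := hp ▸ hj
    rw [hv i hi', hv j hj'] at hij
    have := congrArg Fin.val (P.vinj hij)
    simp only [Fin.val_ofNat] at this
    rwa [Nat.mod_eq_of_lt (by omega), Nat.mod_eq_of_lt (by omega)] at this
  ext e
  rw [mem_edgeSetOf, Walk.edges_copy, mem_edges_iff_getVert, hp]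
  constructor
  · rintro ⟨i, hi, he⟩
    rw [hv i hi.le, hv (i + 1) hi, ← hf i hi] at he
    exact ⟨_, (D.ends_injective he).symm⟩
  · rintro ⟨i, rfl⟩
    exact ⟨i, i.2, by rw [hv i i.2.le, hv (i + 1) i.2, ← hf i i.2]⟩

lemma CycleIn.exists_walk (C : CycleIn D) {x : V} (hx : x ∈ Set.range C.vert) :
    ∃ c : (D.graph Set.univ).Walk x x, c.IsCycle ∧ edgeSetOf c = Set.range C.edge ∧
      {y | y ∈ c.support} = Set.range C.vert := by
  classical
  have hn := C.hn
  have : NeZero C.n := ⟨by omega⟩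
  let f : ℕ → V := fun i => C.vert (Fin.ofNat C.n i)
  have hfi : ∀ i (hi : i < C.n), f i = C.vert ⟨i, hi⟩ := fun i hi =>
    congrArg C.vert (Fin.ext (by simpa using Nat.mod_eq_of_lt hi))
  have hf : ∀ i (hi : i < C.n), D.ends (C.edge ⟨i, hi⟩) = s(f i, f (i + 1)) := fun i hi => by
    have h2 : Fin.ofNat C.n (i + 1) = finRot ⟨i, hi⟩ := rfl
    rw [hfi i hi]
    simp only [f, h2]
    exact C.hinc ⟨i, hi⟩
  have hadj : ∀ i < C.n, (D.graph Set.univ).Adj (f i) (f (i + 1)) :=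
    fun i hi => ⟨C.edge ⟨i, hi⟩, trivial, hf i hi⟩
  obtain ⟨p, hp, hv⟩ := exists_walk_getVert (G := D.graph Set.univ) f C.n hadj
  have hn0 : f C.n = f 0 := congrArg C.vert (Fin.ext (by simp))
  let c := p.copy rfl hn0
  have hsupp : {y | y ∈ c.support} = Set.range C.vert := by
    ext y
    simp only [c, Walk.support_copy]
    rw [Set.mem_ofPred_eq, Walk.mem_support_iff_exists_getVert, hp]
    constructor
    · rintro ⟨i, rfl, hi⟩
      rw [hv i hi]
      exact ⟨_, rfl⟩
    · rintro ⟨i, rfl⟩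
      exact ⟨i, by rw [hv i i.2.le, hfi i i.2], i.2.le⟩
  have hedge : edgeSetOf c = Set.range C.edge := by
    ext e
    rw [mem_edgeSetOf, Walk.edges_copy, mem_edges_iff_getVert, hp]
    constructor
    · rintro ⟨i, hi, he⟩
      rw [hv i hi.le, hv (i + 1) hi, ← hf i hi] at he
      exact ⟨_, (D.ends_injective he).symm⟩
    · rintro ⟨i, rfl⟩
      exact ⟨i, i.2, by rw [hv i i.2.le, hv (i + 1) i.2, ← hf i i.2]⟩
  have hcyc : c.IsCycle := by
    rw [Walk.isCycle_iff_isPath_tail_and_le_length]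
    refine ⟨?_, by simp only [c, Walk.length_copy, hp]; exact hn⟩
    rw [← Walk.IsPath.getVert_injOn_iff]
    have hlen : c.length = C.n := by simp [c, hp]
    intro i hi j hj hij
    have hi' : i ≤ c.tail.length := hi
    have hj' : j ≤ c.tail.length := hj
    have ht : c.tail.length + 1 = c.length :=
      Walk.length_tail_add_one (by rw [← Walk.length_eq_zero_iff]; omega)
    rw [Walk.getVert_tail, Walk.getVert_tail] at hij
    simp only [c, Walk.getVert_copy] at hij
    rw [hv _ (by omega), hv _ (by omega)] at hij
    have := congrArg Fin.val (C.vinj hij)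
    simp only [Fin.val_ofNat] at this
    have hcases : ∀ m, m ≤ C.n → m % C.n = if m = C.n then 0 else m := fun m hm => by
      split_ifs with h
      · simp [h]
      · exact Nat.mod_eq_of_lt (by omega)
    rw [hcases _ (by omega), hcases _ (by omega)] at this
    split_ifs at this <;> omega
  have hx' : x ∈ c.support := by rw [← hsupp] at hx; exact hx
  refine ⟨c.rotate x hx', hcyc.rotate hx', ?_, ?_⟩
  · rw [← hedge]
    ext e
    rw [mem_edgeSetOf, mem_edgeSetOf, (c.rotate_edges x hx').mem_iff]
  · rw [← hsupp]
    ext y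
    simp [Walk.mem_support_rotate_iff]

end Walks

end WOGraph

namespace WOGraph

open SimpleGraph

variable {V E : Type*} {D : WOGraph V E} {S : Set E} {u v w : V}

/-- Two walks with the same endpoints meet in their endpoints only. -/
def IntDisjoint (p q : (D.graph S).Walk u v) : Prop :=
  Disjoint (edgeSetOf p) (edgeSetOf q) ∧ ∀ x ∈ p.support, x ∈ q.support → x = u ∨ x = v

lemma IntDisjoint.symm {p q : (D.graph S).Walk u v} (h : IntDisjoint p q) : IntDisjoint q p :=
  ⟨h.1.symm, fun x hx hx' => h.2 x hx' hx⟩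

/-- The cycle `C` is the union of the two walks `p` and `q`. -/
structure IsUnion (C : CycleIn D) (p q : (D.graph S).Walk u v) : Prop where
  edge : Set.range C.edge = edgeSetOf p ∪ edgeSetOf q
  vert : Set.range C.vert = {x | x ∈ p.support} ∪ {x | x ∈ q.support}

lemma IsUnion.symm {C : CycleIn D} {p q : (D.graph S).Walk u v} (h : IsUnion C p q) :
    IsUnion C q p :=
  ⟨h.edge.trans (Set.union_comm _ _), h.vert.trans (Set.union_comm _ _)⟩

lemma exists_isUnion {p q : (D.graph S).Walk u v} (hp : p.IsPath) (hq : q.IsPath) (huv : u ≠ v)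
    (h : IntDisjoint p q) : ∃ C : CycleIn D, IsUnion C p q := by
  have hc : (p.append q.reverse).IsCycle := by
    refine hp.isCycle_append hq.reverse ?_ ?_
    · intro x hx hx'
      have h1 := hp.support_nodup
      have h2 := hq.reverse.support_nodup
      rw [← Walk.cons_tail_support] at h1 h2
      have h3 := h.2 x (List.mem_of_mem_tail hx) (by simpa using List.mem_of_mem_tail hx')
      rcases h3 with rfl | rfl
      · exact (List.nodup_cons.1 h1).1 hx
      · exact (List.nodup_cons.1 h2).1 hx'
    · have key : ∀ r : (D.graph S).Walk u v, ¬ 1 < r.length → s(u, v) ∈ r.edges := by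
        intro r hr
        cases r with
        | nil => exact absurd rfl huv
        | cons h' r' =>
          cases r' with
          | nil => simp
          | cons => simp at hr
      by_contra! hcon
      rw [Walk.length_reverse] at hcon
      have h1 := key p (by omega)
      obtain ⟨e, -, he, h3⟩ := exists_of_mem_edges h1
      have h2 := key q (by omega)
      rw [← he] at h2
      exact Set.disjoint_left.1 h.1 h3 h2
  obtain ⟨C, h1, h2⟩ := exists_cycleIn hc
  refine ⟨C, by simpa using h1, ?_⟩
  rw [h2]
  ext x
  simp [Walk.mem_support_append_iff]

lemma intDisjoint_of_isCycle {p : (D.graph S).Walk u v} {q : (D.graph S).Walk v u} (huv : u ≠ v)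
    (h : (p.append q).IsCycle) : p.IsPath ∧ q.IsPath ∧ IntDisjoint p q.reverse := by
  refine ⟨h.isPath_of_append_left (Walk.not_nil_of_ne huv.symm),
    h.isPath_of_append_right (Walk.not_nil_of_ne huv), ?_, ?_⟩
  · have h1 := ((Walk.isTrail_append _ _).1 h.isTrail).2.2
    rw [edgeSetOf_reverse]
    exact Set.disjoint_left.2 fun e he he' => h1 he he'
  · have h1 := h.support_nodup
    rw [Walk.tail_support_append, List.nodup_append'] at h1
    intro x hx hx'
    rw [Walk.support_reverse, List.mem_reverse] at hx'
    by_contra! hcon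
    rw [← Walk.cons_tail_support, List.mem_cons] at hx hx'
    exact h1.2.2 (hx.resolve_left hcon.1) (hx'.resolve_left hcon.2)

lemma isCycle_append_swap {G : SimpleGraph V} {p : G.Walk u v} {q : G.Walk v u}
    (h : (p.append q).IsCycle) : (q.append p).IsCycle := by
  rw [Walk.isCycle_def] at h ⊢
  refine ⟨?_, fun h' => h.2.1 ?_, ?_⟩
  · have := h.1
    rw [Walk.isTrail_def, Walk.edges_append] at this ⊢
    exact List.nodup_append_comm.1 this
  · have h1 := congrArg Walk.length h'
    rw [Walk.length_append, Walk.length_nil] at h1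
    rw [Walk.eq_nil_iff_nil, ← Walk.length_eq_zero_iff, Walk.length_append]
    omega
  · have := h.2.2
    rw [Walk.tail_support_append] at this ⊢
    exact List.nodup_append_comm.1 this

lemma CycleIn.exists_append (C : CycleIn D) (hu : u ∈ Set.range C.vert)
    (hv : v ∈ Set.range C.vert) :
    ∃ (p : (D.graph Set.univ).Walk u v) (q : (D.graph Set.univ).Walk v u), (p.append q).IsCycle ∧
      edgeSetOf (p.append q) = Set.range C.edge ∧
      {x | x ∈ (p.append q).support} = Set.range C.vert := by
  classical
  obtain ⟨c, hc, he, hs⟩ := C.exists_walk hu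
  have hv' : v ∈ c.support := by rw [← hs] at hv; exact hv
  exact ⟨c.takeUntil v hv', c.dropUntil v hv', by rwa [Walk.take_spec], by rwa [Walk.take_spec],
    by rwa [Walk.take_spec]⟩

lemma CycleIn.exists_paths (C : CycleIn D) (hu : u ∈ Set.range C.vert)
    (hv : v ∈ Set.range C.vert) (huv : u ≠ v) :
    ∃ p q : (D.graph Set.univ).Walk u v, p.IsPath ∧ q.IsPath ∧ IntDisjoint p q ∧
      IsUnion C p q := by
  obtain ⟨p, q, hc, he, hs⟩ := C.exists_append hu hv
  obtain ⟨hp, hq, hd⟩ := intDisjoint_of_isCycle huv hc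
  refine ⟨p, q.reverse, hp, hq.reverse, hd, ?_, ?_⟩
  · rw [← he]; simp
  · rw [← hs]; ext x; simp [Walk.mem_support_append_iff]

lemma exists_sharePath {C₁ C₂ : CycleIn D} {p q r : (D.graph S).Walk u v} (hp : p.IsPath)
    (huv : u ≠ v) (h : IntDisjoint q r) (h1 : IsUnion C₁ p q) (h2 : IsUnion C₂ p r) :
    ∃ P : PathIn D, SharePath C₁ C₂ P := by
  obtain ⟨P, he, hs, -, -⟩ := exists_pathIn hp huv
  refine ⟨P, ?_, ?_, ?_, ?_⟩
  · rw [he, h1.edge]; exact Set.subset_union_left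
  · rw [he, h2.edge]; exact Set.subset_union_left
  · rw [he, h1.edge, h2.edge, ← Set.union_inter_distrib_left, h.1.inter_eq, Set.union_empty]
  · rw [hs, h1.vert, h2.vert, ← Set.union_inter_distrib_left, Set.union_eq_left]
    rintro x ⟨hx, hx'⟩
    rcases h.2 x hx hx' with rfl | rfl <;> simp

lemma CycleIn.ends_mem (C : CycleIn D) {e : E} (he : e ∈ Set.range C.edge) :
    D.src e ∈ Set.range C.vert ∧ D.tgt e ∈ Set.range C.vert := by
  obtain ⟨i, rfl⟩ := he
  rcases Sym2.eq_iff.1 (C.hinc i) with ⟨h1, h2⟩ | ⟨h1, h2⟩ <;> rw [h1, h2] <;> simp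

lemma CycleIn.exists_incident (C : CycleIn D) (hv : v ∈ Set.range C.vert) :
    ∃ e ∈ Set.range C.edge, D.incident v e := by
  obtain ⟨i, rfl⟩ := hv
  refine ⟨C.edge i, ⟨i, rfl⟩, ?_⟩
  rcases Sym2.eq_iff.1 (C.hinc i) with ⟨h1, h2⟩ | ⟨h1, h2⟩
  · exact Or.inl h1
  · exact Or.inr h2

lemma CycleIn.vert_subset {C C' : CycleIn D} (h : Set.range C.edge ⊆ Set.range C'.edge) :
    Set.range C.vert ⊆ Set.range C'.vert := fun v hv => by
  obtain ⟨e, he, rfl | rfl⟩ := C.exists_incident hv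
  · exact (C'.ends_mem (h he)).1
  · exact (C'.ends_mem (h he)).2

/-- An ear of `C` inside another cycle `C'`, containing a prescribed edge `f`. -/
lemma CycleIn.exists_ear (C C' : CycleIn D) {f : E} (hf : f ∈ Set.range C'.edge)
    (hfC : f ∉ Set.range C.edge) {x y : V} (hxy : x ≠ y)
    (hx : x ∈ Set.range C.vert) (hx' : x ∈ Set.range C'.vert) (hy : y ∈ Set.range C.vert)
    (hy' : y ∈ Set.range C'.vert) :
    ∃ u ∈ Set.range C.vert, ∃ v ∈ Set.range C.vert, u ≠ v ∧
      ∃ p q : (D.graph Set.univ).Walk u v, p.IsPath ∧ q.IsPath ∧ IntDisjoint p q ∧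
        IsUnion C' p q ∧ f ∈ edgeSetOf p ∧ Disjoint (edgeSetOf p) (Set.range C.edge) ∧
        ∀ z ∈ p.support, z ∈ Set.range C.vert → z = u ∨ z = v := by
  classical
  have key : ∀ n : ℕ, ∀ u ∈ Set.range C.vert, ∀ v ∈ Set.range C.vert, u ≠ v →
      ∀ (p : (D.graph Set.univ).Walk u v) (q : (D.graph Set.univ).Walk v u),
        (p.append q).IsCycle → edgeSetOf (p.append q) = Set.range C'.edge →
        {x | x ∈ (p.append q).support} = Set.range C'.vert → f ∈ edgeSetOf p → p.length = n →
    ∃ u ∈ Set.range C.vert, ∃ v ∈ Set.range C.vert, u ≠ v ∧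
      ∃ p q : (D.graph Set.univ).Walk u v, p.IsPath ∧ q.IsPath ∧ IntDisjoint p q ∧
        IsUnion C' p q ∧ f ∈ edgeSetOf p ∧ Disjoint (edgeSetOf p) (Set.range C.edge) ∧
        ∀ z ∈ p.support, z ∈ Set.range C.vert → z = u ∨ z = v := by
    intro n
    induction n using Nat.strong_induction_on with
    | _ n ih =>
    intro u hu v hv huv p q hc he hs hfp hn
    by_cases hint : ∀ z ∈ p.support, z ∈ Set.range C.vert → z = u ∨ z = v
    · obtain ⟨hp, hq, hd⟩ := intDisjoint_of_isCycle huv hc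
      refine ⟨u, hu, v, hv, huv, p, q.reverse, hp, hq.reverse, hd, ⟨?_, ?_⟩, hfp, ?_, hint⟩
      · rw [← he]; simp
      · rw [← hs]; ext x; simp [Walk.mem_support_append_iff]
      · refine Set.disjoint_left.2 fun e hep heC => hfC ?_
        have h1 := hint _ (src_mem_support hep) (C.ends_mem heC).1
        have h2 := hint _ (tgt_mem_support hep) (C.ends_mem heC).2
        have h3 := D.no_loop e
        have h4 : D.ends e = s(u, v) := by
          rcases h1 with h1 | h1 <;> rcases h2 with h2 | h2
          · exact absurd (h1.trans h2.symm) h3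
          · simp [ends, h1, h2]
          · simp [ends, h1, h2, Sym2.eq_swap]
          · exact absurd (h1.trans h2.symm) h3
        have h5 : s(u, v) ∈ p.edges := h4 ▸ hep
        have h6 := hp.eq_adj_toWalk_of_mem_edges h5
        have h7 : D.ends f ∈ p.edges := hfp
        rw [h6] at h7
        have h8 : D.ends f = s(u, v) := by simpa using h7
        rwa [D.ends_injective (h8.trans h4.symm)]
    · push Not at hint
      obtain ⟨z, hzp, hzC, hzu, hzv⟩ := hint
      obtain ⟨a, b, rfl⟩ := Walk.mem_support_iff_exists_append.1 hzp
      have ha : 0 < a.length := by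
        rw [Nat.pos_iff_ne_zero]; exact fun h => hzu (Walk.eq_of_length_eq_zero h).symm
      have hb : 0 < b.length := by
        rw [Nat.pos_iff_ne_zero]; exact fun h => hzv (Walk.eq_of_length_eq_zero h)
      rw [Walk.length_append] at hn
      rw [edgeSetOf_append] at hfp
      rcases hfp with hfa | hfb
      · rw [← Walk.append_assoc] at hc he hs
        exact ih a.length (by omega) u hu z hzC (Ne.symm hzu) a (b.append q) hc he hs hfa rfl
      · refine ih b.length (by omega) z hzC v hv hzv b (q.append a) ?_ ?_ ?_ hfb rfl
        · rw [← Walk.append_assoc] at hc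
          rw [Walk.append_assoc]
          exact isCycle_append_swap hc
        · rw [← he]; simp; grind
        · rw [← hs]; ext x; simp [Walk.mem_support_append_iff]; grind
  obtain ⟨p, q, hc, he, hs⟩ := C'.exists_append hx' hy'
  have hf' : f ∈ edgeSetOf p ∪ edgeSetOf q := by rw [← edgeSetOf_append, he]; exact hf
  rcases hf' with hf' | hf'
  · exact key _ x hx y hy hxy p q hc he hs hf' rfl
  · refine key _ y hy x hx hxy.symm q p ?_ ?_ ?_ hf' rfl
    · exact isCycle_append_swap hc
    · rw [← he]; simp [Set.union_comm]
    · rw [← hs]; ext x; simp [Walk.mem_support_append_iff]; grind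

end WOGraph

namespace WOGraph

open SimpleGraph

variable {V E : Type*} (D : WOGraph V E)

/-- The exponent vector of the monomial `x_i x_j ^ w_j` attached to an edge `(x_i, x_j)`. -/
noncomputable def exps (e : E) : V →₀ ℕ :=
  Finsupp.single (D.src e) 1 + Finsupp.single (D.tgt e) (D.w (D.tgt e))

lemma exps_ne_zero (e : E) : D.exps e ≠ 0 := fun h => by
  have := DFunLike.congr_fun h (D.src e)
  simp [exps] at this

lemma toricIdeal_eq_ker (K : Type*) [Field K] :
    D.toricIdeal K = RingHom.ker (monomialMap K D.exps) := by
  have h : (fun e => X (D.src e) * X (D.tgt e) ^ D.w (D.tgt e) : E → MvPolynomial V K) =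
      fun e => monomial (D.exps e) 1 := by
    funext e
    rw [exps, X_pow_eq_monomial, X, monomial_mul, mul_one]
  rw [toricIdeal, h]
  rfl

variable {D}

lemma coe_exps [DecidableEq V] (e : E) (v : V) : (D.exps e v : ℤ) = D.inc v e := by
  have h := D.no_loop e
  by_cases h1 : D.src e = v
  · subst h1
    simp [exps, inc, Ne.symm h]
  · by_cases h2 : D.tgt e = v
    · subst h2
      simp [exps, inc, h]
    · simp [exps, inc, h1, h2]

lemma exps_eq_zero_iff {e : E} {v : V} : D.exps e v = 0 ↔ ¬ D.incident v e := by
  have h := D.wpos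
  by_cases h1 : D.src e = v
  · simp [exps, incident, h1]
  · by_cases h2 : D.tgt e = v
    · subst h2
      simp [exps, incident, h1, (h _).ne']
    · simp [exps, incident, h1, h2]

variable [Fintype E]

lemma sum_mul_exps_eq {n : ℕ} {f : Fin n → E} (hf : Function.Injective f) {c : E → ℤ}
    (hc : vsupp c ⊆ Set.range f) (v : V) :
    ∑ i, c (f i) * D.exps (f i) v = ∑ e, c e * D.exps e v := by
  refine Fintype.sum_of_injective f hf _ _ (fun e he => ?_) fun _ => rfl
  have : c e = 0 := by
    by_contra h
    exact he (hc h)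
  rw [this, zero_mul]

lemma CycleIn.sum_eq_zero_of_notMem (C : CycleIn D) {c : E → ℤ}
    (hc : vsupp c ⊆ Set.range C.edge) {v : V} (hv : v ∉ Set.range C.vert) :
    ∑ e, c e * D.exps e v = 0 := by
  refine Finset.sum_eq_zero fun e _ => ?_
  by_cases h : c e = 0
  · rw [h, zero_mul]
  · have : D.exps e v = 0 := by
      rw [exps_eq_zero_iff]
      rintro (rfl | rfl)
      · exact hv (C.ends_mem (hc h)).1
      · exact hv (C.ends_mem (hc h)).2
    simp [this]

lemma CycleIn.isBalanced_iff [DecidableEq V] (C : CycleIn D) :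
    C.IsBalanced ↔ ∃ c ≠ 0, IsRelation D.exps c ∧ vsupp c ⊆ Set.range C.edge := by
  rw [CycleIn.IsBalanced, ← Matrix.exists_mulVec_eq_zero_iff]
  constructor
  · rintro ⟨x, hx, h⟩
    have hval : ∀ i, Function.extend C.edge x 0 (C.edge i) = x i := C.einj.extend_apply x 0
    have hsupp : vsupp (Function.extend C.edge x 0) ⊆ Set.range C.edge := fun e he => by
      by_contra h'
      exact he (Function.extend_apply' _ _ _ h')
    refine ⟨Function.extend C.edge x 0, fun h0 => hx ?_, fun v => ?_, hsupp⟩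
    · funext i
      rw [← hval, h0]
      rfl
    · by_cases hv : v ∈ Set.range C.vert
      · obtain ⟨i, rfl⟩ := hv
        rw [← sum_mul_exps_eq C.einj hsupp]
        have := congrFun h i
        simp only [Matrix.mulVec, dotProduct, Pi.zero_apply, CycleIn.mat] at this
        rw [← this]
        exact Finset.sum_congr rfl fun j _ => by rw [hval, coe_exps, mul_comm]
      · exact C.sum_eq_zero_of_notMem hsupp hv
  · rintro ⟨c, hc0, hc, hsupp⟩
    refine ⟨c ∘ C.edge, fun h => hc0 ?_, ?_⟩
    · funext e
      by_contra he
      obtain ⟨i, rfl⟩ := hsupp he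
      exact he (congrFun h i)
    · funext i
      have := hc (C.vert i)
      rw [← sum_mul_exps_eq C.einj hsupp] at this
      rw [Pi.zero_apply, ← this, Matrix.mulVec, dotProduct]
      exact Finset.sum_congr rfl fun j _ => by rw [coe_exps, mul_comm]; rfl

/-- A subgraph with more edges than vertices carries a nonzero relation. -/
lemma exists_isRelation_of_ncard_lt (T : Set E) (W : Set V) (hW : W.Finite)
    (h : ∀ e ∈ T, D.src e ∈ W ∧ D.tgt e ∈ W) (hcard : W.ncard < T.ncard) :
    ∃ c ≠ 0, IsRelation D.exps c ∧ vsupp c ⊆ T := by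
  classical
  have := hW.fintype
  have hT : T.Nonempty := by
    rw [← Set.ncard_pos]; omega
  obtain ⟨e₀, he₀⟩ := hT
  have : Nonempty W := ⟨⟨_, (h e₀ he₀).1⟩⟩
  obtain ⟨x, hx, h0, -⟩ := Int.Matrix.exists_ne_zero_int_vec_norm_le
    (Matrix.of fun (v : W) (e : T) => (D.exps e v : ℤ))
    (by rwa [← Nat.card_eq_fintype_card, ← Nat.card_eq_fintype_card, Nat.card_coe_set_eq,
      Nat.card_coe_set_eq]) Fintype.card_pos
  have hval : ∀ i : T, Function.extend Subtype.val x 0 (i : E) = x i :=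
    Subtype.val_injective.extend_apply x 0
  have hsupp : vsupp (Function.extend (Subtype.val : T → E) x 0) ⊆ T := fun e he => by
    by_contra h'
    exact he (Function.extend_apply' _ _ _ (by simpa using h'))
  refine ⟨Function.extend Subtype.val x 0, fun h0 => hx ?_, fun v => ?_, hsupp⟩
  · funext i
    rw [← hval, h0]
    rfl
  · by_cases hv : v ∈ W
    · have := congrFun h0 ⟨v, hv⟩
      simp only [Matrix.mulVec, dotProduct, Pi.zero_apply, Matrix.of_apply] at this
      rw [← this]
      symm
      refine Fintype.sum_of_injective (Subtype.val : T → E) Subtype.val_injective _ _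
        (fun e he => ?_) fun e => by rw [hval, mul_comm]
      have h1 : Function.extend (Subtype.val : T → E) x 0 e = 0 :=
        Function.extend_apply' _ _ _ (by simpa using he)
      rw [h1, zero_mul]
    · refine Finset.sum_eq_zero fun e _ => ?_
      by_cases he : Function.extend (Subtype.val : T → E) x 0 e = 0
      · rw [he, zero_mul]
      · have : D.exps e v = 0 := by
          rw [exps_eq_zero_iff]
          rintro (rfl | rfl)
          · exact hv (h e (hsupp he)).1
          · exact hv (h e (hsupp he)).2
        simp [this]

variable [DecidableEq V]

lemma CycleIn.IsBalanced.mono {C C' : CycleIn D} (hC : C.IsBalanced)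
    (h : Set.range C.edge ⊆ Set.range C'.edge) : C'.IsBalanced := by
  rw [CycleIn.isBalanced_iff] at hC ⊢
  obtain ⟨c, h0, hc, hs⟩ := hC
  exact ⟨c, h0, hc, hs.trans h⟩

end WOGraph

namespace WOGraph

open SimpleGraph

variable {V E : Type*} {D : WOGraph V E} {S : Set E} {u v w : V}

lemma IsUnion.intDisjoint {C : CycleIn D} {a b p : (D.graph S).Walk u v} (h : IsUnion C a b)
    (hd : Disjoint (edgeSetOf p) (Set.range C.edge))
    (hs : ∀ z ∈ p.support, z ∈ Set.range C.vert → z = u ∨ z = v) : IntDisjoint a p := by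
  rw [h.edge, Set.disjoint_union_right] at hd
  exact ⟨hd.1.symm, fun x hx hx' => hs x hx' (by rw [h.vert]; exact Or.inl hx)⟩

lemma exists_incident_of_mem_support {p : (D.graph S).Walk u v} (huv : u ≠ v) {x : V}
    (hx : x ∈ p.support) : ∃ e ∈ edgeSetOf p, D.incident x e := by
  induction p with
  | nil => exact absurd rfl huv
  | @cons a b d h q ih =>
    obtain ⟨e, -, he, he'⟩ := exists_of_mem_edges (p := q.cons h) (x := s(a, b)) (by simp)
    rw [Walk.support_cons, List.mem_cons] at hx
    have key : ∀ x, x = a ∨ x = b → D.incident x e := by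
      rintro x hx
      rcases Sym2.eq_iff.1 he with ⟨h1, h2⟩ | ⟨h1, h2⟩ <;> rcases hx with rfl | rfl <;>
        simp [incident, h1, h2]
    rcases hx with rfl | hx
    · exact ⟨e, he', key _ (Or.inl rfl)⟩
    · by_cases hbd : b = d
      · by_cases hxb : x = b
        · exact ⟨e, he', key _ (Or.inr hxb)⟩
        · obtain ⟨f, hf, hf'⟩ : ∃ f ∈ edgeSetOf q, D.incident x f := by
            obtain ⟨i, rfl, hi⟩ := Walk.mem_support_iff_exists_getVert.1 hx
            cases i with
            | zero => exact absurd (Walk.getVert_zero q) hxb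
            | succ i =>
              obtain ⟨f, hf⟩ := exists_edge_getVert q hi
              refine ⟨f, ?_, ?_⟩
              · rw [mem_edgeSetOf, hf, mem_edges_iff_getVert]
                exact ⟨i, hi, rfl⟩
              · rcases Sym2.eq_iff.1 hf with ⟨h1, h2⟩ | ⟨h1, h2⟩
                · exact Or.inr h2
                · exact Or.inl h1
          rw [edgeSetOf_cons q he]
          exact ⟨f, Or.inr hf, hf'⟩
      · obtain ⟨f, hf, hf'⟩ := ih hbd hx
        rw [edgeSetOf_cons q he]
        exact ⟨f, Or.inr hf, hf'⟩

/-- The two new cycles obtained by attaching the path `p` to the cycle `C`. -/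
lemma CycleIn.exists_theta (C : CycleIn D) (hu : u ∈ Set.range C.vert)
    (hv : v ∈ Set.range C.vert) (huv : u ≠ v) {p : (D.graph Set.univ).Walk u v} (hp : p.IsPath)
    (hd : Disjoint (edgeSetOf p) (Set.range C.edge))
    (hs : ∀ z ∈ p.support, z ∈ Set.range C.vert → z = u ∨ z = v) :
    ∃ (a b : (D.graph Set.univ).Walk u v) (C' C'' : CycleIn D), a.IsPath ∧ b.IsPath ∧
      IntDisjoint a b ∧ IntDisjoint a p ∧ IntDisjoint b p ∧ IsUnion C a b ∧ IsUnion C' a p ∧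
      IsUnion C'' b p ∧ Set.range C'.edge ≠ Set.range C''.edge := by
  obtain ⟨a, b, ha, hb, hab, h⟩ := C.exists_paths hu hv huv
  have hap := h.intDisjoint hd hs
  have hbp := h.symm.intDisjoint hd hs
  obtain ⟨C', hC'⟩ := exists_isUnion ha hp huv hap
  obtain ⟨C'', hC''⟩ := exists_isUnion hb hp huv hbp
  refine ⟨a, b, C', C'', ha, hb, hab, hap, hbp, h, hC', hC'', fun heq => ?_⟩
  rw [hC'.edge, hC''.edge] at heq
  obtain ⟨e, he⟩ := edgeSetOf_nonempty (p := a) huv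
  have : e ∈ edgeSetOf b ∪ edgeSetOf p := heq ▸ Or.inl he
  rcases this with h' | h'
  · exact Set.disjoint_left.1 hab.1 he h'
  · exact Set.disjoint_left.1 hap.1 he h'

lemma IsUnion.ne_of_disjoint {C C' : CycleIn D} {a p : (D.graph S).Walk u v} (huv : u ≠ v)
    (h : IsUnion C' a p) (hd : Disjoint (edgeSetOf p) (Set.range C.edge)) :
    Set.range C.edge ≠ Set.range C'.edge := fun heq => by
  obtain ⟨e, he⟩ := edgeSetOf_nonempty (p := p) huv
  refine Set.disjoint_left.1 hd he ?_
  rw [heq, h.edge]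
  exact Or.inr he

variable [DecidableEq V]

variable (D) in
/-- All unbalanced cycles have one of two edge sets. -/
def AtMostTwo : Prop :=
  ∃ S₁ S₂ : Set E, ∀ C : CycleIn D, C.IsUnbalanced →
    Set.range C.edge = S₁ ∨ Set.range C.edge = S₂

variable (D) in
/-- No two balanced cycles share a path. -/
def NoSharedPath : Prop :=
  ∀ C₁ C₂ : CycleIn D, C₁.IsBalanced → C₂.IsBalanced → ∀ P : PathIn D, ¬ SharePath C₁ C₂ P

lemma AtMostTwo.false_of_three (h2 : AtMostTwo D) {C₁ C₂ C₃ : CycleIn D} (h₁ : ¬ C₁.IsBalanced)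
    (h₂ : ¬ C₂.IsBalanced) (h₃ : ¬ C₃.IsBalanced) (h12 : Set.range C₁.edge ≠ Set.range C₂.edge)
    (h13 : Set.range C₁.edge ≠ Set.range C₃.edge) (h23 : Set.range C₂.edge ≠ Set.range C₃.edge) :
    False := by
  obtain ⟨S₁, S₂, h⟩ := h2
  have a := h C₁ h₁
  have b := h C₂ h₂
  have c := h C₃ h₃
  grind

lemma NoSharedPath.not_isBalanced (hii : NoSharedPath D) {C₁ C₂ : CycleIn D}
    {p q r : (D.graph S).Walk u v} (hp : p.IsPath) (huv : u ≠ v) (h : IntDisjoint q r)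
    (h1 : IsUnion C₁ p q) (h2 : IsUnion C₂ p r) (hC : C₁.IsBalanced) : ¬ C₂.IsBalanced := by
  obtain ⟨P, hP⟩ := exists_sharePath hp huv h h1 h2
  exact fun h' => hii _ _ hC h' P hP

/-- Attaching a path to an unbalanced cycle produces a balanced cycle. -/
lemma AtMostTwo.exists_isBalanced (h2 : AtMostTwo D) {C : CycleIn D} (hC : ¬ C.IsBalanced)
    (hu : u ∈ Set.range C.vert) (hv : v ∈ Set.range C.vert) (huv : u ≠ v)
    {p : (D.graph Set.univ).Walk u v} (hp : p.IsPath)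
    (hd : Disjoint (edgeSetOf p) (Set.range C.edge))
    (hs : ∀ z ∈ p.support, z ∈ Set.range C.vert → z = u ∨ z = v) :
    ∃ C' : CycleIn D, C'.IsBalanced ∧ Set.range C'.edge ⊆ Set.range C.edge ∪ edgeSetOf p := by
  obtain ⟨a, b, C', C'', -, -, -, -, -, h, h', h'', hne⟩ := C.exists_theta hu hv huv hp hd hs
  by_contra! hcon
  refine h2.false_of_three hC (C₂ := C') (C₃ := C'') (fun hb => hcon _ hb ?_)
    (fun hb => hcon _ hb ?_) (h'.ne_of_disjoint huv hd) (h''.ne_of_disjoint huv hd) hne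
  · rw [h'.edge, h.edge]; grind
  · rw [h''.edge, h.edge]; grind

/-- Distinct balanced cycles have no edge in common. -/
lemma disjoint_of_isBalanced (h2 : AtMostTwo D) (hii : NoSharedPath D) {C₁ C₂ : CycleIn D}
    (h₁ : C₁.IsBalanced) (h₂ : C₂.IsBalanced) (hne : Set.range C₁.edge ≠ Set.range C₂.edge) :
    Disjoint (Set.range C₁.edge) (Set.range C₂.edge) := by
  by_contra hnd
  wlog hsub : ¬ Set.range C₂.edge ⊆ Set.range C₁.edge generalizing C₁ C₂
  · rw [not_not] at hsub
    exact this h₂ h₁ hne.symm (fun h => hnd h.symm) fun h => hne (h.antisymm hsub)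
  obtain ⟨e, he1, he2⟩ := Set.not_disjoint_iff.1 hnd
  obtain ⟨f, hf2, hf1⟩ := Set.not_subset.1 hsub
  have hear := fun f hf2 hf1 => C₁.exists_ear C₂ (f := f) hf2 hf1 (D.no_loop e) (C₁.ends_mem he1).1
    (C₂.ends_mem he2).1 (C₁.ends_mem he1).2 (C₂.ends_mem he2).2
  obtain ⟨u, hu, v, hv, huv, p, q, hp, hq, hpq, hU, hfp, hd, hs⟩ := hear f hf2 hf1
  obtain ⟨a, b, C', C'', ha, hb, hab, hap, hbp, h, h', h'', hne'⟩ :=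
    C₁.exists_theta hu hv huv hp hd hs
  have hC' : ¬ C'.IsBalanced := hii.not_isBalanced ha huv hbp h h' h₁
  have hC'' : ¬ C''.IsBalanced := hii.not_isBalanced hb huv hap h.symm h'' h₁
  have hsubp : ∀ f' ∈ Set.range C₂.edge, f' ∉ Set.range C₁.edge → f' ∈ edgeSetOf p := by
    intro f' hf2' hf1'
    obtain ⟨u', hu', v', hv', huv', p', q', hp', -, -, -, hfp', hd', hs'⟩ := hear f' hf2' hf1'
    obtain ⟨a', b', C₃, -, ha', -, -, -, hbp', k, k', -, -⟩ :=
      C₁.exists_theta hu' hv' huv' hp' hd' hs'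
    have hC₃ : ¬ C₃.IsBalanced := hii.not_isBalanced ha' huv' hbp' k k' h₁
    have hmem : f' ∈ Set.range C₃.edge := by rw [k'.edge]; exact Or.inr hfp'
    rw [h.edge] at hf1'
    by_contra hcon
    refine h2.false_of_three hC' hC'' hC₃ hne' (fun heq => ?_) (fun heq => ?_)
    · rw [← heq, h'.edge] at hmem; grind
    · rw [← heq, h''.edge] at hmem; grind
  have hqC : edgeSetOf q ⊆ Set.range C₁.edge := fun x hx => by
    by_contra hx'
    exact Set.disjoint_right.1 hpq.1 hx (hsubp x (by rw [hU.edge]; exact Or.inr hx) hx')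
  obtain ⟨P, hPe, hPs, -, -⟩ := exists_pathIn hq huv
  refine hii C₁ C₂ h₁ h₂ P ⟨hPe ▸ hqC, ?_, ?_, ?_⟩
  · rw [hPe, hU.edge]; exact Set.subset_union_right
  · rw [hPe, hU.edge, Set.inter_union_distrib_left, hd.symm.inter_eq, Set.empty_union,
      Set.inter_eq_right.2 hqC]
  · have hqs : {x | x ∈ q.support} ⊆ Set.range C₁.vert := fun x hx => by
      obtain ⟨e, he, rfl | rfl⟩ := exists_incident_of_mem_support huv hx
      · exact (C₁.ends_mem (hqC he)).1
      · exact (C₁.ends_mem (hqC he)).2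
    rw [hPs, hU.vert, Set.inter_union_distrib_left, Set.inter_eq_right.2 hqs, Set.union_eq_right]
    rintro x ⟨hx, hx'⟩
    rcases hs x hx' hx with rfl | rfl <;> simp

/-- A balanced cycle has no edge in common with an unbalanced cycle that is edge-disjoint from
another unbalanced cycle. -/
lemma disjoint_of_isUnbalanced [Fintype E] (h2 : AtMostTwo D) (hii : NoSharedPath D)
    {C U₁ U₂ : CycleIn D} (hC : C.IsBalanced) (h₁ : ¬ U₁.IsBalanced) (h₂ : ¬ U₂.IsBalanced)
    (hU : Disjoint (Set.range U₁.edge) (Set.range U₂.edge)) :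
    Disjoint (Set.range C.edge) (Set.range U₁.edge) := by
  by_contra hnd
  obtain ⟨e, he, he1⟩ := Set.not_disjoint_iff.1 hnd
  obtain ⟨f, hf, hf1⟩ := Set.not_subset.1 fun h => h₁ (hC.mono h)
  obtain ⟨u, hu, v, hv, huv, p, q, hp, -, -, -, -, hd, hs⟩ := U₁.exists_ear C hf hf1 (D.no_loop e)
    (U₁.ends_mem he1).1 (C.ends_mem he).1 (U₁.ends_mem he1).2 (C.ends_mem he).2
  obtain ⟨a, b, C', C'', ha, hb, hab, hap, hbp, h, h', h'', hne'⟩ :=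
    U₁.exists_theta hu hv huv hp hd hs
  have key : ∀ (a b : (D.graph Set.univ).Walk u v) (C' : CycleIn D), IsUnion U₁ a b →
      IsUnion C' a p → C'.IsBalanced := fun a b C' h h' => by
    by_contra hC'
    obtain ⟨x, hx⟩ := edgeSetOf_nonempty (p := a) huv
    have hx1 : x ∈ Set.range U₁.edge := by rw [h.edge]; exact Or.inl hx
    have hx2 := Set.disjoint_left.1 hU hx1
    refine h2.false_of_three h₁ h₂ hC' (fun heq => hx2 (heq ▸ hx1)) (h'.ne_of_disjoint huv hd)
      fun heq => hx2 ?_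
    rw [heq, h'.edge]
    exact Or.inl hx
  exact hii.not_isBalanced hp huv hab h'.symm h''.symm (key a b C' h h') (key b a C'' h.symm h'')

end WOGraph

namespace WOGraph

open SimpleGraph

variable {V E : Type*} {D : WOGraph V E} {S T : Set E} {u v w : V}

lemma reachable_of_edgeSetOf_subset (p : (D.graph S).Walk u v) (h : edgeSetOf p ⊆ T) :
    (D.graph T).Reachable u v :=
  ⟨p.transfer (D.graph T) fun x hx => by
    obtain ⟨e, -, rfl, he⟩ := exists_of_mem_edges hx
    exact ⟨e, h he, rfl⟩⟩

lemma CycleIn.reachable (C : CycleIn D) {e : E} (he : e ∉ Set.range C.edge)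
    (hu : u ∈ Set.range C.vert) (hv : v ∈ Set.range C.vert) : (D.graph {e}ᶜ).Reachable u v := by
  by_cases huv : u = v
  · rw [huv]
  · obtain ⟨p, q, -, -, -, h⟩ := C.exists_paths hu hv huv
    refine reachable_of_edgeSetOf_subset p fun x hx hxe => he ?_
    rw [← Set.mem_singleton_iff.1 hxe, h.edge]
    exact Or.inl hx

lemma reachable_of_isPath {p : (D.graph S).Walk u v} (hp : p.IsPath) {e : E}
    (he : e ∈ edgeSetOf p) (h : (D.graph {e}ᶜ).Reachable u v) :
    (D.graph {e}ᶜ).Reachable (D.src e) (D.tgt e) := by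
  induction p with
  | nil => simp [mem_edgeSetOf] at he
  | @cons a b d h' q ih =>
    have hnd := hp.isTrail.edges_nodup
    rw [Walk.edges_cons, List.nodup_cons] at hnd
    obtain ⟨f, -, hf, -⟩ := exists_of_mem_edges (p := q.cons h') (x := s(a, b)) (by simp)
    rw [edgeSetOf_cons q hf] at he
    by_cases hef : e = f
    · subst hef
      have hq : (D.graph {e}ᶜ).Reachable b d := reachable_of_edgeSetOf_subset q fun x hx hxe => by
        rw [Set.mem_singleton_iff.1 hxe, mem_edgeSetOf, hf] at hx
        exact hnd.1 hx
      have hab := h.trans hq.symm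
      rcases Sym2.eq_iff.1 hf with ⟨h1, h2⟩ | ⟨h1, h2⟩
      · rwa [h1, h2]
      · rw [h1, h2]; exact hab.symm
    · have hab : (D.graph {e}ᶜ).Adj a b := ⟨f, fun h => hef (Set.mem_singleton_iff.1 h).symm, hf⟩
      exact ih hp.of_cons (he.resolve_left hef) (hab.reachable.symm.trans h)

lemma ne_of_ends {e : E} (h : D.ends e = s(v, w)) : v ≠ w := by
  rintro rfl
  rcases Sym2.eq_iff.1 h with ⟨h1, h2⟩ | ⟨h1, h2⟩ <;> exact D.no_loop e (h1.trans h2.symm)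

lemma edgeSetOf_toWalk {g : E} (hg : D.ends g = s(u, v)) (h : (D.graph S).Adj u v) :
    edgeSetOf h.toWalk = {g} := by
  ext x
  simp [mem_edgeSetOf, ← D.ends_injective.eq_iff (a := x), hg]

lemma exists_cycleIn_of_isPath {p : (D.graph Set.univ).Walk u v} (hp : p.IsPath) {g : E}
    (hg : D.ends g = s(u, v)) (hgp : g ∉ edgeSetOf p) :
    ∃ C : CycleIn D, Set.range C.edge = insert g (edgeSetOf p) ∧
      Set.range C.vert = {x | x ∈ p.support} := by
  classical
  have hadj : (D.graph Set.univ).Adj u v := ⟨g, trivial, hg⟩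
  obtain ⟨C, hC⟩ := exists_isUnion hp hadj.isPath_toWalk (ne_of_ends hg)
    ⟨by rw [edgeSetOf_toWalk hg]; exact Set.disjoint_singleton_right.2 hgp,
      fun x _ hx => by simpa using hx⟩
  refine ⟨C, by rw [hC.edge, edgeSetOf_toWalk hg, Set.union_singleton], ?_⟩
  rw [hC.vert, Set.union_eq_left]
  intro x hx
  have hx' : x = u ∨ x = v := by simpa using hx
  rcases hx' with rfl | rfl
  · exact p.start_mem_support
  · exact p.end_mem_support

lemma exists_cycleIn_of_reachable {e : E} (h : (D.graph {e}ᶜ).Reachable (D.src e) (D.tgt e)) :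
    ∃ C : CycleIn D, e ∈ Set.range C.edge := by
  classical
  obtain ⟨p, hp⟩ := h.exists_isPath
  obtain ⟨C, hC, -⟩ := exists_cycleIn_of_isPath (hp.mapLe (graph_mono (Set.subset_univ _)))
    (g := e) rfl (by
      rw [edgeSetOf_mapLe (Set.subset_univ _)]
      exact fun h => edgeSetOf_subset p h rfl)
  exact ⟨C, hC ▸ Set.mem_insert _ _⟩

lemma CycleIn.disjoint_edge {C C' : CycleIn D} {x : V}
    (h : Set.range C.vert ∩ Set.range C'.vert ⊆ {x}) :
    Disjoint (Set.range C.edge) (Set.range C'.edge) :=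
  Set.disjoint_left.2 fun e he he' => D.no_loop e <|
    (h ⟨(C.ends_mem he).1, (C'.ends_mem he').1⟩ : D.src e = x).trans
      (h ⟨(C.ends_mem he).2, (C'.ends_mem he').2⟩ : D.tgt e = x).symm

lemma ShareOneVertex.disjoint {U₁ U₂ : CycleIn D} (h : ShareOneVertex U₁ U₂) :
    Disjoint (Set.range U₁.edge) (Set.range U₂.edge) := Set.disjoint_iff_inter_eq_empty.2 h.2

lemma ConnectedByPath.disjoint {U₁ U₂ : CycleIn D} {P : PathIn D} (h : ConnectedByPath U₁ U₂ P) :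
    Disjoint (Set.range U₁.edge) (Set.range U₂.edge) :=
  CycleIn.disjoint_edge (x := P.vert 0) (by rw [h.1]; exact Set.empty_subset _)

lemma CycleIn.vert_eq {C C' : CycleIn D} (h : Set.range C.edge = Set.range C'.edge) :
    Set.range C.vert = Set.range C'.vert :=
  (vert_subset h.le).antisymm (vert_subset h.ge)

lemma CycleIn.edge_nonempty (C : CycleIn D) : (Set.range C.edge).Nonempty :=
  ⟨C.edge ⟨0, by have := C.hn; omega⟩, Set.mem_range_self _⟩

variable [DecidableEq V]

variable (D) in
/-- The edge sets of two unbalanced cycles meeting in a vertex or connected by a path. -/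
def IsHandcuff (S : Set E) : Prop :=
  ∃ U₁ U₂ : CycleIn D, U₁.IsUnbalanced ∧ U₂.IsUnbalanced ∧
    ((ShareOneVertex U₁ U₂ ∧ S = Set.range U₁.edge ∪ Set.range U₂.edge) ∨
      ∃ P : PathIn D, ConnectedByPath U₁ U₂ P ∧
        S = Set.range U₁.edge ∪ Set.range U₂.edge ∪ Set.range P.edge)

variable (D) in
/-- No balanced cycle shares an edge with a path connecting two unbalanced cycles. -/
def PathFree : Prop :=
  ∀ C₁ C₂ : CycleIn D, C₁.IsUnbalanced → C₂.IsUnbalanced →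
    ∀ P : PathIn D, ConnectedByPath C₁ C₂ P →
      ∀ C : CycleIn D, C.IsBalanced → Set.range C.edge ∩ Set.range P.edge = ∅

lemma AtMostTwo.eq_or_eq (h2 : AtMostTwo D) {U₁ U₂ : CycleIn D} (h₁ : U₁.IsUnbalanced)
    (h₂ : U₂.IsUnbalanced) (hd : Disjoint (Set.range U₁.edge) (Set.range U₂.edge))
    {C : CycleIn D} (hC : C.IsUnbalanced) :
    Set.range C.edge = Set.range U₁.edge ∨ Set.range C.edge = Set.range U₂.edge := by
  by_contra! hcon
  exact h2.false_of_three hC h₁ h₂ hcon.1 hcon.2 (hd.ne U₁.edge_nonempty.ne_empty)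

lemma AtMostTwo.pair_eq (h2 : AtMostTwo D) {U₁ U₂ U₁' U₂' : CycleIn D} (h₁ : U₁.IsUnbalanced)
    (h₂ : U₂.IsUnbalanced) (hd : Disjoint (Set.range U₁.edge) (Set.range U₂.edge))
    (h₁' : U₁'.IsUnbalanced) (h₂' : U₂'.IsUnbalanced)
    (hd' : Disjoint (Set.range U₁'.edge) (Set.range U₂'.edge)) :
    (Set.range U₁'.edge = Set.range U₁.edge ∧ Set.range U₂'.edge = Set.range U₂.edge) ∨
      (Set.range U₁'.edge = Set.range U₂.edge ∧ Set.range U₂'.edge = Set.range U₁.edge) := by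
  have hne := hd'.ne U₁'.edge_nonempty.ne_empty
  rcases h2.eq_or_eq h₁ h₂ hd h₁' with h | h <;> rcases h2.eq_or_eq h₁ h₂ hd h₂' with h' | h'
  · exact absurd (h.trans h'.symm) hne
  · exact Or.inl ⟨h, h'⟩
  · exact Or.inr ⟨h, h'⟩
  · exact absurd (h.trans h'.symm) hne

lemma ConnectedByPath.edge_subset (h2 : AtMostTwo D) (hi : PathFree D) {U₁ U₂ U₁' U₂' : CycleIn D}
    (h₁ : U₁.IsUnbalanced) (h₂ : U₂.IsUnbalanced) (h₁' : U₁'.IsUnbalanced) (h₂' : U₂'.IsUnbalanced)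
    {P P' : PathIn D} (h : ConnectedByPath U₁ U₂ P) (h' : ConnectedByPath U₁' U₂' P') :
    Set.range P.edge ⊆ Set.range P'.edge := by
  intro e he
  by_contra he'
  have heU : e ∉ Set.range U₁.edge ∪ Set.range U₂.edge := fun hU =>
    Set.notMem_empty e (h.2.2.2.2.2 ▸ ⟨he, hU⟩)
  rw [Set.mem_union, not_or] at heU
  obtain ⟨p, hp, hpe⟩ := P.exists_walk
  obtain ⟨p', -, hpe'⟩ := P'.exists_walk
  have hr : (D.graph {e}ᶜ).Reachable (P'.vert 0) (P'.vert (Fin.last P'.k)) :=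
    reachable_of_edgeSetOf_subset p' fun x hx hxe => he' <| by
      rwa [← Set.mem_singleton_iff.1 hxe, ← hpe']
  have hreach : (D.graph {e}ᶜ).Reachable (P.vert 0) (P.vert (Fin.last P.k)) := by
    have k1 := h'.2.1
    have k2 := h'.2.2.1
    rcases h2.pair_eq h₁ h₂ h.disjoint h₁' h₂' h'.disjoint with ⟨ha, hb⟩ | ⟨ha, hb⟩
    · rw [CycleIn.vert_eq ha] at k1
      rw [CycleIn.vert_eq hb] at k2
      exact (U₁.reachable heU.1 h.2.1 k1).trans (hr.trans (U₂.reachable heU.2 k2 h.2.2.1))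
    · rw [CycleIn.vert_eq ha] at k1
      rw [CycleIn.vert_eq hb] at k2
      exact (U₁.reachable heU.1 h.2.1 k2).trans (hr.symm.trans (U₂.reachable heU.2 k1 h.2.2.1))
  obtain ⟨C, hC⟩ := exists_cycleIn_of_reachable (reachable_of_isPath hp (hpe ▸ he) hreach)
  by_cases hb : C.IsBalanced
  · exact Set.notMem_empty e (hi U₁ U₂ h₁ h₂ P h C hb ▸ ⟨hC, he⟩)
  · rcases h2.eq_or_eq h₁ h₂ h.disjoint hb with hU | hU
    · exact heU.1 (hU ▸ hC)
    · exact heU.2 (hU ▸ hC)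

lemma ShareOneVertex.not_connectedByPath (h2 : AtMostTwo D) {U₁ U₂ U₁' U₂' : CycleIn D}
    (h₁ : U₁.IsUnbalanced) (h₂ : U₂.IsUnbalanced) (h₁' : U₁'.IsUnbalanced) (h₂' : U₂'.IsUnbalanced)
    (h : ShareOneVertex U₁ U₂) (P : PathIn D) : ¬ ConnectedByPath U₁' U₂' P := fun h' => by
  obtain ⟨x, hx⟩ := h.1
  have h0 := h'.1
  rcases h2.pair_eq h₁ h₂ h.disjoint h₁' h₂' h'.disjoint with ⟨ha, hb⟩ | ⟨ha, hb⟩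
  · rw [CycleIn.vert_eq ha, CycleIn.vert_eq hb, hx] at h0
    exact Set.singleton_ne_empty x h0
  · rw [CycleIn.vert_eq ha, CycleIn.vert_eq hb, Set.inter_comm, hx] at h0
    exact Set.singleton_ne_empty x h0

lemma IsHandcuff.unique (h2 : AtMostTwo D) (hi : PathFree D) (hS : IsHandcuff D S)
    (hT : IsHandcuff D T) : S = T := by
  obtain ⟨U₁, U₂, h₁, h₂, h⟩ := hS
  obtain ⟨U₁', U₂', h₁', h₂', h'⟩ := hT
  have key : ∀ {U₁ U₂ U₁' U₂' : CycleIn D}, U₁.IsUnbalanced → U₂.IsUnbalanced →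
      Disjoint (Set.range U₁.edge) (Set.range U₂.edge) → U₁'.IsUnbalanced → U₂'.IsUnbalanced →
      Disjoint (Set.range U₁'.edge) (Set.range U₂'.edge) →
      Set.range U₁.edge ∪ Set.range U₂.edge = Set.range U₁'.edge ∪ Set.range U₂'.edge := by
    intro U₁ U₂ U₁' U₂' h₁ h₂ hd h₁' h₂' hd'
    rcases h2.pair_eq h₁ h₂ hd h₁' h₂' hd' with ⟨ha, hb⟩ | ⟨ha, hb⟩
    · rw [ha, hb]
    · rw [ha, hb, Set.union_comm]
  rcases h with ⟨h, rfl⟩ | ⟨P, h, rfl⟩ <;> rcases h' with ⟨h', rfl⟩ | ⟨P', h', rfl⟩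
  · exact key h₁ h₂ h.disjoint h₁' h₂' h'.disjoint
  · exact absurd h' (h.not_connectedByPath h2 h₁ h₂ h₁' h₂' P')
  · exact absurd h (h'.not_connectedByPath h2 h₁' h₂' h₁ h₂ P)
  · rw [key h₁ h₂ h.disjoint h₁' h₂' h'.disjoint,
      (h.edge_subset h2 hi h₁ h₂ h₁' h₂' h').antisymm (h'.edge_subset h2 hi h₁' h₂' h₁ h₂ h)]

lemma IsHandcuff.disjoint [Fintype E] (h2 : AtMostTwo D) (hi : PathFree D) (hii : NoSharedPath D)
    (hS : IsHandcuff D S) {C : CycleIn D} (hC : C.IsBalanced) : Disjoint (Set.range C.edge) S := by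
  obtain ⟨U₁, U₂, h₁, h₂, h⟩ := hS
  have hd : Disjoint (Set.range U₁.edge) (Set.range U₂.edge) := by
    rcases h with ⟨h, -⟩ | ⟨P, h, -⟩
    · exact h.disjoint
    · exact h.disjoint
  have k1 := disjoint_of_isUnbalanced h2 hii hC h₁ h₂ hd
  have k2 := disjoint_of_isUnbalanced h2 hii hC h₂ h₁ hd.symm
  rcases h with ⟨h, rfl⟩ | ⟨P, h, rfl⟩
  · exact Set.disjoint_union_right.2 ⟨k1, k2⟩
  · exact Set.disjoint_union_right.2 ⟨Set.disjoint_union_right.2 ⟨k1, k2⟩,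
      Set.disjoint_iff_inter_eq_empty.2 (hi _ _ h₁ h₂ P h C hC)⟩

lemma ncard_range_fin {α : Type*} {n : ℕ} {f : Fin n → α} (hf : Function.Injective f) :
    (Set.range f).ncard = n := by
  rw [← Set.image_univ, Set.ncard_image_of_injective _ hf, Set.ncard_univ, Nat.card_eq_fintype_card,
    Fintype.card_fin]

/-- A handcuff has one more edge than vertices and therefore carries a relation. -/
lemma IsHandcuff.exists_isRelation [Fintype E] (hS : IsHandcuff D S) :
    ∃ c ≠ 0, IsRelation D.exps c ∧ vsupp c ⊆ S := by
  obtain ⟨U₁, U₂, -, -, h⟩ := hS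
  have hv1 := ncard_range_fin U₁.vinj
  have hv2 := ncard_range_fin U₂.vinj
  have he1 := ncard_range_fin U₁.einj
  have he2 := ncard_range_fin U₂.einj
  have hf1 := Set.finite_range U₁.vert
  have hf2 := Set.finite_range U₂.vert
  have hvu := Set.ncard_union_add_ncard_inter (Set.range U₁.vert) (Set.range U₂.vert)
  rcases h with ⟨h, rfl⟩ | ⟨P, h, rfl⟩
  · obtain ⟨x, hx⟩ := h.1
    rw [hx, Set.ncard_singleton] at hvu
    refine exists_isRelation_of_ncard_lt _ (Set.range U₁.vert ∪ Set.range U₂.vert)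
      (hf1.union hf2) ?_ ?_
    · rintro e (he | he)
      · exact ⟨Or.inl (U₁.ends_mem he).1, Or.inl (U₁.ends_mem he).2⟩
      · exact ⟨Or.inr (U₂.ends_mem he).1, Or.inr (U₂.ends_mem he).2⟩
    · rw [Set.ncard_union_eq h.disjoint]
      omega
  · have hf3 := Set.finite_range P.vert
    have hv3 := ncard_range_fin P.vinj
    have he3 := ncard_range_fin P.einj
    rw [h.1, Set.ncard_empty] at hvu
    have hvu' := Set.ncard_union_add_ncard_inter (Set.range U₁.vert ∪ Set.range U₂.vert)
      (Set.range P.vert) (hf1.union hf2)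
    have h2 : 2 ≤ ((Set.range U₁.vert ∪ Set.range U₂.vert) ∩ Set.range P.vert).ncard := by
      have hne : P.vert 0 ≠ P.vert (Fin.last P.k) := fun heq => by
        have := congrArg Fin.val (P.vinj heq)
        have := P.hk
        simp at *
        omega
      rw [← Set.ncard_pair hne]
      refine Set.ncard_le_ncard ?_ (hf3.subset Set.inter_subset_right)
      rintro x (rfl | rfl)
      · exact ⟨Or.inl h.2.1, Set.mem_range_self _⟩
      · exact ⟨Or.inr h.2.2.1, Set.mem_range_self _⟩
    refine exists_isRelation_of_ncard_lt _
      (Set.range U₁.vert ∪ Set.range U₂.vert ∪ Set.range P.vert) ((hf1.union hf2).union hf3) ?_ ?_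
    · rintro e ((he | he) | ⟨i, rfl⟩)
      · exact ⟨Or.inl (Or.inl (U₁.ends_mem he).1), Or.inl (Or.inl (U₁.ends_mem he).2)⟩
      · exact ⟨Or.inl (Or.inr (U₂.ends_mem he).1), Or.inl (Or.inr (U₂.ends_mem he).2)⟩
      · rcases Sym2.eq_iff.1 (P.hinc i) with ⟨h1, h2⟩ | ⟨h1, h2⟩ <;> rw [h1, h2] <;>
          exact ⟨Or.inr (Set.mem_range_self _), Or.inr (Set.mem_range_self _)⟩
    · rw [Set.ncard_union_eq (Set.disjoint_iff_inter_eq_empty.2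
        ((Set.inter_comm _ _).trans h.2.2.2.2.2)), Set.ncard_union_eq h.disjoint]
      omega

end WOGraph

namespace WOGraph

open SimpleGraph

variable {V E : Type*} {D : WOGraph V E} {S : Set E} {u v w : V}

lemma incident.exists_ends {e : E} (h : D.incident v e) : ∃ w, D.ends e = s(v, w) := by
  rcases h with rfl | rfl
  · exact ⟨_, rfl⟩
  · exact ⟨_, Sym2.eq_swap⟩

lemma incident_of_ends {e : E} (h : D.ends e = s(v, w)) : D.incident v e := by
  rcases Sym2.eq_iff.1 h with ⟨h1, -⟩ | ⟨-, h1⟩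
  · exact Or.inl h1
  · exact Or.inr h1

lemma CycleIn.mem_of_incident (C : CycleIn D) {e : E} (he : e ∈ Set.range C.edge)
    (h : D.incident v e) : v ∈ Set.range C.vert := by
  rcases h with rfl | rfl
  · exact (C.ends_mem he).1
  · exact (C.ends_mem he).2

/-- Every vertex incident with an edge of the support of a relation is incident with two. -/
lemma exists_incident_ne_of_isRelation [Fintype E] {c : E → ℤ} (hc : IsRelation D.exps c) {e : E}
    (he : e ∈ vsupp c) (hv : D.incident v e) : ∃ e' ∈ vsupp c, e' ≠ e ∧ D.incident v e' := by
  by_contra! h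
  have hsum := hc v
  rw [Finset.sum_eq_single e] at hsum
  · rcases mul_eq_zero.1 hsum with h0 | h0
    · exact he h0
    · exact exps_eq_zero_iff.1 (by exact_mod_cast h0) hv
  · intro e' _ hne
    by_cases h0 : c e' = 0
    · rw [h0, zero_mul]
    · rw [exps_eq_zero_iff.2 (h e' h0 hne), Nat.cast_zero, mul_zero]
  · exact fun h => absurd (Finset.mem_univ e) h

/-- A path in a set of edges without leaves extends to one whose last vertex is joined by a further
edge to the path itself or to a prescribed set `X` of vertices. -/
lemma exists_lollipop [Fintype V]
    (hS : ∀ e ∈ S, ∀ v, D.incident v e → ∃ e' ∈ S, e' ≠ e ∧ D.incident v e') (X : Set V)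
    {p : (D.graph Set.univ).Walk u v} (hp : p.IsPath) (huv : u ≠ v) (hpS : edgeSetOf p ⊆ S)
    (hX : ∀ z ∈ p.support, z ∈ X → z = u) :
    ∃ (x : V) (q : (D.graph Set.univ).Walk u x), q.IsPath ∧ u ≠ x ∧ edgeSetOf q ⊆ S ∧
      (∀ z ∈ q.support, z ∈ X → z = u) ∧
      ∃ g ∈ S, g ∉ edgeSetOf q ∧ ∃ y, D.ends g = s(x, y) ∧ (y ∈ X ∨ y ∈ q.support) := by
  obtain ⟨n, hn⟩ : ∃ n, Fintype.card V ≤ p.length + n := ⟨_, Nat.le_add_left _ _⟩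
  induction n generalizing v with
  | zero => exact absurd hp.length_lt (not_lt.2 hn)
  | succ n ih =>
    obtain ⟨e, he, hev⟩ := exists_incident_of_mem_support huv p.end_mem_support
    obtain ⟨g, hg, hne, hgv⟩ := hS e (hpS he) v hev
    obtain ⟨a, ha⟩ := hev.exists_ends
    obtain ⟨y, hy⟩ := hgv.exists_ends
    have hgp : g ∉ edgeSetOf p := fun h => hne <| D.ends_injective <| by
      rw [mem_edgeSetOf, ha] at he
      rw [mem_edgeSetOf, hy] at h
      rw [ha, hy, hp.eq_penultimate_of_mem_edges he, hp.eq_penultimate_of_mem_edges h]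
    by_cases hyX : y ∈ X ∨ y ∈ p.support
    · exact ⟨v, p, hp, huv, hpS, hX, g, hg, hgp, y, hy, hyX⟩
    · rw [not_or] at hyX
      have hadj : (D.graph Set.univ).Adj v y := ⟨g, trivial, hy⟩
      refine ih (p := p.concat hadj) (hp.concat hyX.2 hadj)
        (fun h => hyX.2 (h ▸ p.start_mem_support)) ?_ ?_ ?_
      · intro f hf
        rw [mem_edgeSetOf, Walk.edges_concat, List.concat_eq_append, List.mem_append,
          List.mem_singleton, ← hy, D.ends_injective.eq_iff] at hf
        rcases hf with hf | rfl
        · exact hpS hf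
        · exact hg
      · intro z hz hzX
        rw [Walk.support_concat, List.mem_append, List.mem_singleton] at hz
        rcases hz with hz | rfl
        · exact hX z hz hzX
        · exact absurd hzX hyX.1
      · rw [Walk.length_concat]; omega

/-- The cycle closed up by an edge from the end of a path to one of its vertices. -/
lemma exists_cycleIn_of_append {x y : V} {p : (D.graph Set.univ).Walk u y}
    {q : (D.graph Set.univ).Walk y x} (hp : (p.append q).IsPath) {g : E}
    (hg : D.ends g = s(x, y)) (hgp : g ∉ edgeSetOf (p.append q)) :
    ∃ C : CycleIn D, Set.range C.edge = insert g (edgeSetOf q) ∧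
      Set.range C.vert = {x | x ∈ q.support} :=
  exists_cycleIn_of_isPath hp.of_append_right (hg.trans Sym2.eq_swap) fun h => hgp (by simp [h])

/-- A relation whose support contains a cycle is supported by the cycle, or has a further edge at
one of its vertices. -/
lemma exists_notMem_incident_of_isRelation [Fintype E] [DecidableEq V] {c : E → ℤ}
    (hc : IsRelation D.exps c) {C : CycleIn D} (hC : C.IsUnbalanced)
    (hCc : Set.range C.edge ⊆ vsupp c) :
    ∃ e ∈ vsupp c, e ∉ Set.range C.edge ∧ ∃ v ∈ Set.range C.vert, D.incident v e := by
  classical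
  by_contra! h
  refine hC (C.isBalanced_iff.2 ⟨fun e => if e ∈ Set.range C.edge then c e else 0, ?_, ?_, ?_⟩)
  · obtain ⟨e, he⟩ := C.edge_nonempty
    intro h0
    exact hCc he ((if_pos he).symm.trans (congrFun h0 e))
  · intro v
    by_cases hv : v ∈ Set.range C.vert
    · refine (Finset.sum_congr rfl fun e _ => ?_).trans (hc v)
      beta_reduce
      by_cases he : e ∈ Set.range C.edge
      · rw [if_pos he]
      · rw [if_neg he]
        by_cases h0 : c e = 0
        · rw [h0]
        · rw [exps_eq_zero_iff.2 (h e h0 he v hv), Nat.cast_zero, mul_zero, mul_zero]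
    · refine C.sum_eq_zero_of_notMem (fun e he => ?_) hv
      by_contra h'
      exact he (if_neg h')
  · intro e he
    by_contra h'
    exact he (if_neg h')

/-- The handcuff formed by two unbalanced cycles and a path running from one to the other. -/
lemma exists_isHandcuff [DecidableEq V] {U : CycleIn D} (hU : U.IsUnbalanced) {x y : V}
    {p : (D.graph Set.univ).Walk u y} {q : (D.graph Set.univ).Walk y x}
    (hp : (p.append q).IsPath) (hu : u ∈ Set.range U.vert)
    (hs : ∀ z ∈ (p.append q).support, z ∈ Set.range U.vert → z = u) {C : CycleIn D}
    (hC : C.IsUnbalanced) (hCv : Set.range C.vert = {x | x ∈ q.support}) :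
    ∃ T, IsHandcuff D T ∧ T ⊆ Set.range U.edge ∪ Set.range C.edge ∪ edgeSetOf p := by
  by_cases huy : u = y
  · subst huy
    have hv : Set.range U.vert ∩ Set.range C.vert = {u} := by
      refine Set.Subset.antisymm ?_ ?_
      · rintro z ⟨hz, hz'⟩
        rw [hCv] at hz'
        exact hs z (Walk.mem_support_append_iff _ _ |>.2 (Or.inr hz')) hz
      · rintro _ rfl
        exact ⟨hu, hCv ▸ q.start_mem_support⟩
    exact ⟨_, ⟨U, C, hU, hC, Or.inl ⟨⟨⟨u, hv⟩,
      Set.disjoint_iff_inter_eq_empty.1 (CycleIn.disjoint_edge hv.le)⟩, rfl⟩⟩,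
      Set.subset_union_left⟩
  · obtain ⟨P, hPe, hPv, hP0, hPl⟩ := exists_pathIn hp.of_append_left huy
    have hPmem : ∀ i, P.vert i ∈ p.support := fun i => by
      have := Set.mem_range_self (f := P.vert) i
      rwa [hPv] at this
    have hpq : ∀ z ∈ p.support, z ∈ q.support → z = y := by
      intro z hz hz'
      have hnd := hp.support_nodup
      rw [Walk.support_append] at hnd
      exact ((Walk.mem_support_iff _).1 hz').resolve_right (List.disjoint_of_nodup_append hnd hz)
    have huq : u ∉ q.support := fun h => huy (hpq u p.start_mem_support h)
    refine ⟨_, ⟨U, C, hU, hC, Or.inr ⟨P, ⟨?_, ?_, ?_, ?_, ?_, ?_⟩, rfl⟩⟩, by rw [hPe]⟩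
    · refine Set.eq_empty_of_forall_notMem ?_
      rintro z ⟨hz, hz'⟩
      rw [hCv] at hz'
      exact huq (hs z (Walk.mem_support_append_iff _ _ |>.2 (Or.inr hz')) hz ▸ hz')
    · rwa [hP0]
    · rw [hPl, hCv]; exact q.start_mem_support
    · intro i hi hmem
      exact hi (P.vinj ((hs _ (Walk.mem_support_append_iff _ _ |>.2 (Or.inl (hPmem i))) hmem).trans
        hP0.symm))
    · intro i hi hmem
      rw [hCv] at hmem
      exact hi (P.vinj ((hpq _ (hPmem i) hmem).trans hPl.symm))
    · refine Set.eq_empty_of_forall_notMem ?_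
      rintro e ⟨he, he' | he'⟩
      · rw [hPe] at he
        have h1 := hs _ (Walk.mem_support_append_iff _ _ |>.2 (Or.inl (src_mem_support he)))
          (U.ends_mem he').1
        have h2 := hs _ (Walk.mem_support_append_iff _ _ |>.2 (Or.inl (tgt_mem_support he)))
          (U.ends_mem he').2
        exact D.no_loop e (h1.trans h2.symm)
      · rw [hPe] at he
        have h1 := C.ends_mem he'
        rw [hCv] at h1
        exact D.no_loop e ((hpq _ (src_mem_support he) h1.1).trans
          (hpq _ (tgt_mem_support he) h1.2).symm)

/-- The support of a relation contains a balanced cycle or a handcuff. -/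
lemma exists_subset_vsupp_of_isRelation [Fintype V] [Fintype E] [DecidableEq V] (h2 : AtMostTwo D)
    {c : E → ℤ} (h0 : c ≠ 0) (hc : IsRelation D.exps c) :
    (∃ C : CycleIn D, C.IsBalanced ∧ Set.range C.edge ⊆ vsupp c) ∨
      ∃ T, IsHandcuff D T ∧ T ⊆ vsupp c := by
  rw [or_iff_not_imp_left]
  intro hnb
  push Not at hnb
  have hdeg : ∀ e ∈ vsupp c, ∀ v, D.incident v e → ∃ e' ∈ vsupp c, e' ≠ e ∧ D.incident v e' :=
    fun e he v hv => exists_incident_ne_of_isRelation hc he hv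
  obtain ⟨e, he⟩ := Function.ne_iff.1 h0
  have hadj : (D.graph Set.univ).Adj (D.src e) (D.tgt e) := ⟨e, trivial, rfl⟩
  obtain ⟨x, p, hp, -, hpS, -, g, hg, hgp, y, hgy, hy⟩ := exists_lollipop hdeg ∅ hadj.isPath_toWalk
    hadj.ne (by rw [edgeSetOf_toWalk rfl]; exact Set.singleton_subset_iff.2 he)
    (fun _ _ h => absurd h (Set.notMem_empty _))
  obtain ⟨p₁, p₂, rfl⟩ := Walk.mem_support_iff_exists_append.1
    (hy.resolve_left (Set.notMem_empty y))
  obtain ⟨U, hUe, -⟩ := exists_cycleIn_of_append hp hgy hgp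
  rw [edgeSetOf_append, Set.union_subset_iff] at hpS
  have hUS : Set.range U.edge ⊆ vsupp c := hUe ▸ Set.insert_subset hg hpS.2
  have hU : U.IsUnbalanced := fun h => hnb U h hUS
  have hear : ∀ {a b : V} {q : (D.graph Set.univ).Walk a b}, q.IsPath → a ≠ b →
      a ∈ Set.range U.vert → b ∈ Set.range U.vert → edgeSetOf q ⊆ vsupp c →
      Disjoint (edgeSetOf q) (Set.range U.edge) →
      ¬ ∀ z ∈ q.support, z ∈ Set.range U.vert → z = a ∨ z = b := by
    intro a b q hq hab ha hb hqS hd hs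
    obtain ⟨C, hC, hCs⟩ := h2.exists_isBalanced hU ha hb hab hq hd hs
    exact hnb C hC (hCs.trans (Set.union_subset hUS hqS))
  clear hUe hpS hgp hgy hy hg hp p₁ p₂ hadj he e g y x
  obtain ⟨e, he, heU, v, hv, hve⟩ := exists_notMem_incident_of_isRelation hc hU hUS
  obtain ⟨w, hw⟩ := hve.exists_ends
  have hadj : (D.graph Set.univ).Adj v w := ⟨e, trivial, hw⟩
  have heS : edgeSetOf hadj.toWalk ⊆ vsupp c := by
    rw [edgeSetOf_toWalk hw]; exact Set.singleton_subset_iff.2 he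
  have hwU : w ∉ Set.range U.vert := fun hwU => hear hadj.isPath_toWalk hadj.ne hv hwU heS
    (by rw [edgeSetOf_toWalk hw]; exact Set.disjoint_singleton_left.2 heU)
    (fun z hz _ => by simpa using hz)
  obtain ⟨x, p, hp, hvx, hpS, hpU, g, hg, hgp, y, hgy, hy⟩ :=
    exists_lollipop hdeg (Set.range U.vert) hadj.isPath_toWalk hadj.ne heS fun z hz hzU => by
      have hz' : z = v ∨ z = w := by simpa using hz
      rcases hz' with rfl | rfl
      · rfl
      · exact absurd hzU hwU
  have hxU : x ∉ Set.range U.vert := fun h => hvx (hpU x p.end_mem_support h).symm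
  have hgU : g ∉ Set.range U.edge := fun h => hxU (U.mem_of_incident h (incident_of_ends hgy))
  by_cases hyp : y ∈ p.support
  · obtain ⟨p₁, p₂, rfl⟩ := Walk.mem_support_iff_exists_append.1 hyp
    obtain ⟨C, hCe, hCv⟩ := exists_cycleIn_of_append hp hgy hgp
    rw [edgeSetOf_append, Set.union_subset_iff] at hpS
    have hCS : Set.range C.edge ⊆ vsupp c := hCe ▸ Set.insert_subset hg hpS.2
    obtain ⟨T, hT, hTs⟩ := exists_isHandcuff hU hp hv hpU (fun h => hnb C h hCS) hCv
    exact ⟨T, hT, hTs.trans (Set.union_subset (Set.union_subset hUS hCS) hpS.1)⟩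
  · have hyU := hy.resolve_right hyp
    have hxy : (D.graph Set.univ).Adj x y := ⟨g, trivial, hgy⟩
    have hce : edgeSetOf (p.concat hxy) = edgeSetOf p ∪ {g} := by
      rw [Walk.concat_eq_append, edgeSetOf_append]
      exact congrArg _ (edgeSetOf_toWalk hgy hxy)
    refine absurd ?_ (hear (hp.concat hyp hxy) (fun h => hyp (h ▸ p.start_mem_support)) hv hyU
      ?_ ?_)
    · intro z hz hzU
      rw [Walk.support_concat, List.mem_append, List.mem_singleton] at hz
      exact hz.imp_left fun hz => hpU z hz hzU
    · rw [hce]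
      exact Set.union_subset hpS (Set.singleton_subset_iff.2 hg)
    · rw [hce, Set.disjoint_union_left, Set.disjoint_singleton_left]
      refine ⟨Set.disjoint_left.2 fun f hf hf' => D.no_loop f ?_, hgU⟩
      exact (hpU _ (src_mem_support hf) (U.ends_mem hf').1).trans
        (hpU _ (tgt_mem_support hf) (U.ends_mem hf').2).symm

end WOGraph

open WOGraph in
/-- Corollary 3.7(a),(b). Under the hypotheses of Theorem 3.5,
`I_D` is a complete intersection ideal (generated by a regular sequence) and its
minimal number of generators is `b_D + 1` if `D` has two unbalanced cycles
sharing a vertex or connected by a path, and `b_D` otherwise, where `b_D` is the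
number of balanced cycles of `D`. -/
theorem stmt6 {V E : Type*} [Fintype V] [Fintype E] [DecidableEq V]
    (K : Type*) [Field K] (D : WOGraph V E)
    (h2 : ∃ S₁ S₂ : Set E, ∀ C : CycleIn D, C.IsUnbalanced →
      Set.range C.edge = S₁ ∨ Set.range C.edge = S₂)
    (hi : ∀ C₁ C₂ : CycleIn D, C₁.IsUnbalanced → C₂.IsUnbalanced →
      ∀ P : PathIn D, ConnectedByPath C₁ C₂ P →
        ∀ C : CycleIn D, C.IsBalanced →
          Set.range C.edge ∩ Set.range P.edge = ∅)
    (hii : ∀ C₁ C₂ : CycleIn D, C₁.IsBalanced → C₂.IsBalanced →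
      ∀ P : PathIn D, ¬ SharePath C₁ C₂ P)
    (bD : ℕ)
    (hbD : bD = Set.ncard
      {S : Set E | ∃ C : CycleIn D, C.IsBalanced ∧ Set.range C.edge = S}) :
    (∃ L : List (MvPolynomial E K),
        RingTheory.Sequence.IsRegular (MvPolynomial E K) L ∧
        Ideal.span {x | x ∈ L} = D.toricIdeal K) ∧
    (((∃ C₁ C₂ : CycleIn D, C₁.IsUnbalanced ∧ C₂.IsUnbalanced ∧
          ShareOneVertex C₁ C₂) ∨
        (∃ (C₁ C₂ : CycleIn D) (P : PathIn D), C₁.IsUnbalanced ∧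
          C₂.IsUnbalanced ∧ ConnectedByPath C₁ C₂ P)) →
        IsLeast {r : ℕ | ∃ S : Finset (MvPolynomial E K), S.card = r ∧
          Ideal.span (↑S : Set (MvPolynomial E K)) = D.toricIdeal K} (bD + 1)) ∧
    ((¬ ((∃ C₁ C₂ : CycleIn D, C₁.IsUnbalanced ∧ C₂.IsUnbalanced ∧
          ShareOneVertex C₁ C₂) ∨
        (∃ (C₁ C₂ : CycleIn D) (P : PathIn D), C₁.IsUnbalanced ∧
          C₂.IsUnbalanced ∧ ConnectedByPath C₁ C₂ P))) →
        IsLeast {r : ℕ | ∃ S : Finset (MvPolynomial E K), S.card = r ∧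
          Ideal.span (↑S : Set (MvPolynomial E K)) = D.toricIdeal K} bD) := by
  classical
  let 𝓑 : Set (Set E) := {S | ∃ C : CycleIn D, C.IsBalanced ∧ Set.range C.edge = S}
  let 𝓗 : Set (Set E) := {S | D.IsHandcuff S}
  have hdis : Disjoint 𝓑 𝓗 := by
    refine Set.disjoint_left.2 ?_
    rintro _ ⟨C, hC, rfl⟩ hS
    exact C.edge_nonempty.ne_empty (disjoint_self.1 (hS.disjoint h2 hi hii hC))
  obtain ⟨b, hb⟩ := exists_isDisjointBasis (a := D.exps) D.exps_ne_zero (𝓑 ∪ 𝓗)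
    (by
      rintro S (⟨C, hC, rfl⟩ | hS) T (⟨C', hC', rfl⟩ | hT) hne
      · exact disjoint_of_isBalanced h2 hii hC hC' hne
      · exact hT.disjoint h2 hi hii hC
      · exact (hS.disjoint h2 hi hii hC').symm
      · exact absurd (hS.unique h2 hi hT) hne)
    (by
      rintro S (⟨C, hC, rfl⟩ | ⟨U, U', -, -, ⟨-, rfl⟩ | ⟨P, -, rfl⟩⟩)
      · exact C.edge_nonempty
      · exact U.edge_nonempty.inl
      · exact U.edge_nonempty.inl.inl)
    (by
      rintro S (⟨C, hC, rfl⟩ | hS)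
      · exact C.isBalanced_iff.1 hC
      · exact hS.exists_isRelation)
    (by
      intro c h0 hc
      rcases exists_subset_vsupp_of_isRelation h2 h0 hc with ⟨C, hC, hCs⟩ | ⟨T, hT, hTs⟩
      · exact ⟨_, Or.inl ⟨C, hC, rfl⟩, hCs⟩
      · exact ⟨T, Or.inr hT, hTs⟩)
  have hcard : Fintype.card ↑(𝓑 ∪ 𝓗) = bD + 𝓗.ncard := by
    rw [hbD, ← Set.ncard_union_eq hdis, Set.ncard_eq_toFinset_card', Set.toFinset_card]
  have hleast := hb.isLeast_card K
  rw [hcard] at hleast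
  simp only [D.toricIdeal_eq_ker K]
  refine ⟨hb.exists_isRegular K, fun h => ?_, fun h => ?_⟩
  · obtain ⟨S, hS⟩ : 𝓗.Nonempty := by
      rcases h with ⟨U₁, U₂, h₁, h₂, h⟩ | ⟨U₁, U₂, P, h₁, h₂, h⟩
      · exact ⟨_, U₁, U₂, h₁, h₂, Or.inl ⟨h, rfl⟩⟩
      · exact ⟨_, U₁, U₂, h₁, h₂, Or.inr ⟨P, h, rfl⟩⟩
    have hone : 𝓗 = {S} := Set.eq_singleton_iff_unique_mem.2 ⟨hS, fun T hT => hT.unique h2 hi hS⟩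
    rwa [hone, Set.ncard_singleton] at hleast
  · have hempty : 𝓗 = ∅ := by
      refine Set.eq_empty_of_forall_notMem ?_
      rintro S ⟨U₁, U₂, h₁, h₂, ⟨hU, -⟩ | ⟨P, hU, -⟩⟩
      · exact h (Or.inl ⟨U₁, U₂, h₁, h₂, hU⟩)
      · exact h (Or.inr ⟨U₁, U₂, P, h₁, h₂, hU⟩)
    rwa [hempty, Set.ncard_empty, add_zero] at hleast
end

section
/- Let D be a weighted oriented graph and let D′ be the weighted oriented graph obtained from D by replacing the weights of all sink vertices of D by 1 (keeping all vertices, edges and orientations the same). Then I_D = I_{D′}; in particular, the generators of the toric ideal I_D are independent of the weights of the sink vertices of D. -/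
open MvPolynomial Finset

/-- Raising each variable to a positive power is an injective endomorphism of a
polynomial ring over a field. -/
theorem aeval_X_pow_injective {V K : Type*} [Field K] (k : V → ℕ) (hk : ∀ v, 0 < k v) :
    Function.Injective (aeval (R := K) (fun v => X v ^ k v) :
      MvPolynomial V K →ₐ[K] MvPolynomial V K) := by
  have h := MvPolynomial.algebraicIndependent_polynomial_aeval_X (R := K)
    (fun v => Polynomial.X ^ k v) fun v => (Polynomial.transcendental_X K).pow (hk v)
  simpa [AlgebraicIndependent] using h

/-- If every edge monomial of `D` is obtained from that of `D'` by raising the variables to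
positive powers, then the toric ideals agree. -/
theorem WOGraph.toricIdeal_eq_of_weights {V E : Type*} (K : Type*) [Field K]
    (D D' : WOGraph V E) (hsrc : D'.src = D.src) (htgt : D'.tgt = D.tgt)
    (k : V → ℕ) (hk : ∀ v, 0 < k v) (hk_src : ∀ e, k (D.src e) = 1)
    (hw : ∀ v, D.w v = k v * D'.w v) :
    D.toricIdeal K = D'.toricIdeal K := by
  have hcomp : (aeval (R := K)
        (fun e => X (D.src e) * X (D.tgt e) ^ D.w (D.tgt e)) :
          MvPolynomial E K →ₐ[K] MvPolynomial V K) =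
      (aeval (fun v => X v ^ k v)).comp
        (aeval (fun e => X (D'.src e) * X (D'.tgt e) ^ D'.w (D'.tgt e))) := by
    refine MvPolynomial.algHom_ext fun e => ?_
    simp [hsrc, htgt, hk_src, hw, pow_mul]
  ext p
  simp only [toricIdeal, AlgHom.toRingHom_eq_coe, RingHom.mem_ker, RingHom.coe_coe, hcomp,
    AlgHom.comp_apply]
  exact map_eq_zero_iff _ (aeval_X_pow_injective k hk)

/-- Proposition 3.8. If `D'` is obtained from `D` by replacing
the weights of all sink vertices by `1` (same vertices, edges and orientations,
all other weights unchanged), then `I_D = I_{D'}`: the toric ideal, hence its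
generators, is independent of the weights of the sink vertices. -/
theorem stmt7 {V E : Type*} [Fintype V] [Fintype E] (K : Type*) [Field K]
    (D : WOGraph V E)
    (D' : WOGraph V E) (hsrc : D'.src = D.src) (htgt : D'.tgt = D.tgt)
    (hw₁ : ∀ v : V, D.IsSink v → D'.w v = 1)
    (hw₂ : ∀ v : V, ¬ D.IsSink v → D'.w v = D.w v) :
    D.toricIdeal K = D'.toricIdeal K := by
  classical
  refine WOGraph.toricIdeal_eq_of_weights K D D' hsrc htgt
    (fun v => if D.IsSink v then D.w v else 1) (fun v => ?_) (fun e => ?_) (fun v => ?_)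
  · split_ifs
    exacts [D.wpos v, one_pos]
  · exact if_neg fun h => h e rfl
  · by_cases h : D.IsSink v
    · simp [h, hw₁ v h]
    · simp [h, hw₂ v h]
end

section
/- Let A be an n×m matrix with non-negative integer entries whose null space over ℚ has dimension 1. Then the toric ideal I_A is a principal ideal. -/
open MvPolynomial Finset

/-- The toric ideal of an `n × m` matrix of non-negative integers: the kernel of
`K[e_1,…,e_m] → K[x_1,…,x_n]`, `e_j ↦ ∏ i, x_i ^ (A i j)`. -/
noncomputable def matToricIdeal (K : Type*) [Field K] {n m : ℕ}
    (A : Matrix (Fin n) (Fin m) ℕ) : Ideal (MvPolynomial (Fin m) K) :=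
  RingHom.ker (aeval (R := K)
    (fun j => ∏ i, X i ^ A i j) :
      MvPolynomial (Fin m) K →ₐ[K] MvPolynomial (Fin n) K).toRingHom

/-- The integer kernel of a matrix whose rational null space is a line is cyclic. -/
lemma exists_span_singleton_eq_ker_of_finrank_eq_one {ι κ : Type*} [Fintype ι] [Fintype κ]
    (A : Matrix ι κ ℤ)
    (hnull : Module.finrank ℚ
      (LinearMap.ker (Matrix.mulVecLin (A.map (fun a => (a : ℚ))))) = 1) :
    ∃ b : κ → ℤ, LinearMap.ker A.mulVecLin = Submodule.span ℤ {b} := by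
  classical
  set L := LinearMap.ker A.mulVecLin with hL
  obtain ⟨⟨w, hw⟩, -, hw'⟩ := finrank_eq_one_iff'.mp hnull
  have key : ∀ v ∈ L, ∃ c : ℚ, ∀ j, (v j : ℚ) = c * w j := by
    intro v hv
    have hv' : (fun j => (v j : ℚ)) ∈
        LinearMap.ker (Matrix.mulVecLin (A.map (fun a => (a : ℚ)))) := by
      rw [LinearMap.mem_ker, Matrix.mulVecLin_apply]
      rw [hL, LinearMap.mem_ker, Matrix.mulVecLin_apply] at hv
      funext i
      have := congrArg (Int.cast : ℤ → ℚ) (congrFun hv i)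
      simpa [Matrix.mulVec, dotProduct] using this
    obtain ⟨c, hc⟩ := hw' ⟨_, hv'⟩
    refine ⟨c, fun j => ?_⟩
    have := congrFun (congrArg Subtype.val hc) j
    simpa using this.symm
  let B := Module.Free.chooseBasis ℤ L
  have hsub : ∀ i i' : Module.Free.ChooseBasisIndex ℤ L, i = i' := by
    intro i i'
    by_contra hne
    obtain ⟨c, hc⟩ := key (B i) (B i).2
    obtain ⟨c', hc'⟩ := key (B i') (B i').2
    have hrel : (c'.num * c.den) • B i = (c.num * c'.den) • B i' := by
      ext j
      have h1 := hc j
      have h2 := hc' j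
      have e1 : c * c.den = c.num := Rat.mul_den_eq_num c
      have e2 : c' * c'.den = c'.num := Rat.mul_den_eq_num c'
      have : ((c'.num * c.den * (B i : κ → ℤ) j : ℤ) : ℚ)
          = ((c.num * c'.den * (B i' : κ → ℤ) j : ℤ) : ℚ) := by
        push_cast
        rw [h1, h2, ← e1, ← e2]
        ring
      simpa using (Int.cast_injective this)
    have h0 := congrArg (fun v => B.repr v i) hrel
    have hci : c'.num = 0 := by
      simpa [Finsupp.single_apply, hne, Ne.symm hne] using h0
    have hz : c' = 0 := Rat.num_eq_zero.mp hci
    apply B.ne_zero i'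
    ext j
    have := hc' j
    rw [hz, zero_mul] at this
    exact_mod_cast this
  by_cases hne : Nonempty (Module.Free.ChooseBasisIndex ℤ L)
  · obtain ⟨i⟩ := hne
    refine ⟨B i, le_antisymm (fun v hv => ?_) ?_⟩
    · have := B.sum_repr ⟨v, hv⟩
      rw [Fintype.sum_eq_single i (fun i' h => (h (hsub i' i)).elim)] at this
      exact Submodule.mem_span_singleton.mpr ⟨_, congrArg Subtype.val this⟩
    · rw [Submodule.span_singleton_le_iff_mem]
      exact (B i).2
  · rw [not_nonempty_iff] at hne
    refine ⟨0, ?_⟩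
    rw [Submodule.span_zero_singleton, eq_bot_iff]
    intro v hv
    have := B.sum_repr ⟨v, hv⟩
    rw [Fintype.sum_empty] at this
    exact (congrArg Subtype.val this).symm

lemma binomPlus_pow_eq_monomial (K : Type*) [Field K] {ι : Type*} [Fintype ι] (b : ι → ℤ)
    (k : ℕ) :
    binomPlus K b ^ k =
      monomial (Finsupp.equivFunOnFinite.symm fun e => k * (b e).toNat) 1 := by
  rw [monomial_eq, Finsupp.prod_fintype _ _ (by simp), binomPlus, ← Finset.prod_pow]
  simp [← pow_mul, mul_comm]

lemma binomMinus_eq_binomPlus_neg (K : Type*) [Field K] {ι : Type*} [Fintype ι] (b : ι → ℤ) :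
    binomMinus K b = binomPlus K (-b) := rfl

/-- Monomials whose exponents differ by a natural multiple of `b` are congruent modulo
`f_b`. -/
lemma monomial_sub_monomial_mem_span_binom (K : Type*) [Field K] {ι : Type*} [Fintype ι]
    (b : ι → ℤ) (k : ℕ) (s t : ι →₀ ℕ) (h : ∀ e, (s e : ℤ) - t e = k * b e) (r : K) :
    monomial s r - monomial t r ∈ Ideal.span {binom K b} := by
  let u : ι →₀ ℕ := Finsupp.equivFunOnFinite.symm fun e => s e - k * (b e).toNat
  have hs : s = u + Finsupp.equivFunOnFinite.symm fun e => k * (b e).toNat := by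
    ext e
    have he := h e
    simp only [u, Finsupp.add_apply, Finsupp.equivFunOnFinite_symm_apply_apply]
    rcases le_total 0 (b e) with hb | hb
    · obtain ⟨d, hd⟩ := Int.eq_ofNat_of_zero_le hb
      rw [hd] at he ⊢
      simp only [Int.toNat_natCast]
      zify
      lia
    · simp [Int.toNat_of_nonpos hb]
  have ht : t = u + Finsupp.equivFunOnFinite.symm fun e => k * ((-b) e).toNat := by
    ext e
    have he := h e
    simp only [u, Finsupp.add_apply, Finsupp.equivFunOnFinite_symm_apply_apply, Pi.neg_apply]
    rcases le_total 0 (b e) with hb | hb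
    · obtain ⟨d, hd⟩ := Int.eq_ofNat_of_zero_le hb
      rw [hd] at he ⊢
      simp only [Int.toNat_natCast, Int.toNat_neg_natCast]
      zify
      lia
    · obtain ⟨d, hd⟩ := Int.exists_eq_neg_ofNat hb
      rw [hd] at he ⊢
      simp only [neg_neg, Int.toNat_natCast, Int.toNat_neg_natCast]
      zify
      lia
  have hfac : monomial s r - monomial t r =
      monomial u r * (binomPlus K b ^ k - binomMinus K b ^ k) := by
    rw [binomMinus_eq_binomPlus_neg, binomPlus_pow_eq_monomial, binomPlus_pow_eq_monomial,
      mul_sub, monomial_mul, monomial_mul, mul_one, ← hs, ← ht]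
  rw [hfac, Ideal.mem_span_singleton]
  exact Dvd.dvd.mul_left (sub_dvd_pow_sub_pow _ _ k) _

lemma aeval_prod_X_pow_monomial (K : Type*) [Field K] {n m : ℕ}
    (A : Matrix (Fin n) (Fin m) ℕ) (s : Fin m →₀ ℕ) (r : K) :
    aeval (R := K) (fun j => ∏ i, (X i : MvPolynomial (Fin n) K) ^ A i j) (monomial s r) =
      monomial (Finsupp.equivFunOnFinite.symm (A.mulVec s)) r := by
  rw [aeval_monomial, monomial_eq, Finsupp.prod_fintype _ _ (by simp),
    Finsupp.prod_fintype _ _ (by simp)]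
  simp only [← Finset.prod_pow, ← pow_mul, Finsupp.equivFunOnFinite_symm_apply_apply,
    Matrix.mulVec, dotProduct, ← Finset.prod_pow_eq_pow_sum]
  rw [Finset.prod_comm]
  rfl

lemma mem_matToricIdeal (K : Type*) [Field K] {n m : ℕ} (A : Matrix (Fin n) (Fin m) ℕ)
    (g : MvPolynomial (Fin m) K) :
    g ∈ matToricIdeal K A ↔
      aeval (R := K) (fun j => ∏ i, (X i : MvPolynomial (Fin n) K) ^ A i j) g = 0 :=
  Iff.rfl

lemma mulVec_eq_mulVec_iff_sub_mem_ker {n m : ℕ} (A : Matrix (Fin n) (Fin m) ℕ)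
    (s t : Fin m → ℕ) :
    A.mulVec s = A.mulVec t ↔
      (fun j => (s j : ℤ) - t j) ∈ LinearMap.ker (A.map (fun a => (a : ℤ))).mulVecLin := by
  rw [LinearMap.mem_ker, Matrix.mulVecLin_apply, funext_iff, funext_iff]
  refine forall_congr' fun i => ?_
  simp only [Matrix.mulVec, dotProduct, Matrix.map_apply, Pi.zero_apply, mul_sub,
    Finset.sum_sub_distrib, sub_eq_zero]
  norm_cast

/-- Remark 4.3(i). If the null space over `ℚ` of a matrix `A`
of non-negative integers is one-dimensional, then the toric ideal `I_A` is
principal. -/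
theorem stmt9 (K : Type*) [Field K] {n m : ℕ} (A : Matrix (Fin n) (Fin m) ℕ)
    (hnull : Module.finrank ℚ
      (LinearMap.ker (Matrix.mulVecLin (A.map (fun a => (a : ℚ))))) = 1) :
    ∃ f : MvPolynomial (Fin m) K, matToricIdeal K A = Ideal.span {f} := by
  have hcast : (A.map (fun a => (a : ℤ))).map (fun a => (a : ℚ)) =
      A.map (fun a => (a : ℚ)) := by
    ext i j
    simp
  obtain ⟨b, hb⟩ := exists_span_singleton_eq_ker_of_finrank_eq_one
    (A.map (fun a => (a : ℤ))) (hcast ▸ hnull)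
  refine ⟨binom K b, le_antisymm (fun g hg => ?_) ?_⟩
  · rw [mem_matToricIdeal] at hg
    have hcongr : ∀ (s t : Fin m →₀ ℕ) (r : K), A.mulVec s = A.mulVec t →
        monomial s r - monomial t r ∈ Ideal.span {binom K b} := by
      intro s t r h
      rw [mulVec_eq_mulVec_iff_sub_mem_ker, hb, Submodule.mem_span_singleton] at h
      obtain ⟨k, hk⟩ := h
      have hk' : ∀ e, (s e : ℤ) - t e = k * b e := fun e => (congrFun hk e).symm
      rcases le_total 0 k with hk0 | hk0
      · obtain ⟨d, rfl⟩ := Int.eq_ofNat_of_zero_le hk0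
        exact monomial_sub_monomial_mem_span_binom K b d s t hk' r
      · obtain ⟨d, rfl⟩ := Int.exists_eq_neg_ofNat hk0
        rw [← neg_sub]
        refine neg_mem (monomial_sub_monomial_mem_span_binom K b d t s (fun e => ?_) r)
        linarith [hk' e]
    let deg : (Fin m →₀ ℕ) → (Fin n →₀ ℕ) :=
      fun s => Finsupp.equivFunOnFinite.symm (A.mulVec s)
    let Ψ : MvPolynomial (Fin n) K →ₗ[K] MvPolynomial (Fin m) K :=
      (basisMonomials (Fin n) K).constr K fun d => monomial (Function.invFun deg d) 1
    have hΨ : ∀ d r, Ψ (monomial d r) = monomial (Function.invFun deg d) r := by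
      intro d r
      have h1 : monomial d r = r • basisMonomials (Fin n) K d := by
        simp [smul_monomial]
      rw [h1, map_smul, Module.Basis.constr_basis, smul_monomial, smul_eq_mul, mul_one]
    have hmod : ∀ p : MvPolynomial (Fin m) K,
        p - Ψ (aeval (R := K) (fun j => ∏ i, X i ^ A i j) p) ∈ Ideal.span {binom K b} := by
      intro p
      induction p using MvPolynomial.induction_on' with
      | monomial s r =>
        rw [aeval_prod_X_pow_monomial, hΨ]
        refine hcongr _ _ _ ?_
        have h : deg (Function.invFun deg (deg s)) = deg s := Function.invFun_eq ⟨s, rfl⟩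
        exact (Finsupp.equivFunOnFinite.symm.injective h).symm
      | add p q hp hq =>
        rw [map_add, map_add, add_sub_add_comm]
        exact add_mem hp hq
    have := hmod g
    rwa [hg, map_zero, sub_zero] at this
  · rw [Ideal.span_singleton_le_iff_mem, mem_matToricIdeal, binom, binomMinus_eq_binomPlus_neg,
      ← pow_one (binomPlus K b), ← pow_one (binomPlus K (-b)), binomPlus_pow_eq_monomial,
      binomPlus_pow_eq_monomial, map_sub, aeval_prod_X_pow_monomial, aeval_prod_X_pow_monomial,
      sub_eq_zero]
    congr 2
    apply congrArg
    rw [mulVec_eq_mulVec_iff_sub_mem_ker, hb]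
    convert Submodule.mem_span_singleton_self b using 1
    funext e
    simp only [Finsupp.equivFunOnFinite_symm_apply_apply, one_mul, Pi.neg_apply]
    lia
end

section
/- Let C_{2n} be a balanced weighted oriented cycle on vertices v_1,…,v_{2n} with the usual labelling, with incidence matrix A(C_{2n}). Then the toric ideal I_{C_{2n}} is generated by the primitive binomial f_c, where c = (1/d)·((−1)^{i+1} M_{2n−1}(A(C_{2n})[1|i]))_{i=1}^{2n} ∈ ℤ^{2n} and d = gcd(M_{2n−1}(A(C_{2n})[1|i]) : 1 ≤ i ≤ 2n). -/
open MvPolynomial Finset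

section MonomialMap

variable {K : Type*} [Field K] {ι σ : Type*}

/-- The kernel of a monomial map is contained in every ideal that contains all the binomials of
pairs of monomials with the same image. -/
theorem ker_le_of_monomial_sub_mem (T : (ι →₀ ℕ) → (σ →₀ ℕ))
    (φ : MvPolynomial ι K →ₐ[K] MvPolynomial σ K)
    (hφ : ∀ u a, φ (monomial u a) = monomial (T u) a) (J : Ideal (MvPolynomial ι K))
    (hJ : ∀ u v, T u = T v → (monomial u 1 - monomial v 1 : MvPolynomial ι K) ∈ J) :
    RingHom.ker φ.toRingHom ≤ J := by
  let g : (σ →₀ ℕ) → (ι →₀ ℕ) := Function.invFun T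
  let s : MvPolynomial σ K →ₗ[K] MvPolynomial ι K :=
    (MvPolynomial.basisMonomials σ K).constr K fun m => monomial (g m) 1
  have hs : ∀ m a, s (monomial m a) = monomial (g m) a := fun m a => by
    have h : s (monomial m 1) = monomial (g m) 1 := by
      have := (MvPolynomial.basisMonomials σ K).constr_basis K
        (fun m => (monomial (g m) 1 : MvPolynomial ι K)) m
      simpa using this
    rw [← mul_one a, ← smul_eq_mul, ← smul_monomial, map_smul, h, smul_monomial]
  have key : ∀ f, f - s (φ f) ∈ J := fun f => by
    induction f using MvPolynomial.induction_on' with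
    | monomial u a =>
      have hu : T u = T (g (T u)) := (Function.invFun_eq ⟨u, rfl⟩).symm
      have := J.mul_mem_left (C a) (hJ _ _ hu)
      rw [hφ, hs]
      simpa [mul_sub, C_mul_monomial] using this
    | add p q hp hq =>
      rw [map_add, map_add, add_sub_add_comm]
      exact J.add_mem hp hq
  intro f hf
  have hf' : φ f = 0 := hf
  simpa [hf'] using key f

variable [Fintype ι]

theorem binomPlus_eq_monomial (b : ι → ℤ) :
    binomPlus K b = monomial (Finsupp.equivFunOnFinite.symm fun e => (b e).toNat) 1 := by
  rw [monomial_eq, Finsupp.prod_fintype _ _ (by simp)]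
  simp [binomPlus]

theorem binomMinus_eq_monomial (b : ι → ℤ) :
    binomMinus K b = monomial (Finsupp.equivFunOnFinite.symm fun e => (-b e).toNat) 1 := by
  rw [monomial_eq, Finsupp.prod_fintype _ _ (by simp)]
  simp [binomMinus]

theorem monomial_sub_mem_span_binom_of_nat (c : ι → ℤ) (u v : ι →₀ ℕ) (k : ℕ)
    (h : ∀ e, (u e : ℤ) - v e = k * c e) :
    (monomial u 1 - monomial v 1 : MvPolynomial ι K) ∈ Ideal.span {binom K c} := by
  let p : ι →₀ ℕ := Finsupp.equivFunOnFinite.symm fun e => (c e).toNat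
  let m : ι →₀ ℕ := Finsupp.equivFunOnFinite.symm fun e => (-c e).toNat
  have hle : k • p ≤ u := fun e => by
    have he := h e
    change k * (c e).toNat ≤ u e
    rcases le_total 0 (c e) with h0 | h0
    · zify
      rw [Int.toNat_of_nonneg h0]
      omega
    · simp [Int.toNat_of_nonpos h0]
  have hu : u = (u - k • p) + k • p := (tsub_add_cancel_of_le hle).symm
  have hv : v = (u - k • p) + k • m := by
    ext e
    have he := h e
    have hle' : k * (c e).toNat ≤ u e := hle e
    change v e = (u e - k * (c e).toNat) + k * (-c e).toNat
    zify [hle']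
    have : ((c e).toNat : ℤ) - (-c e).toNat = c e := Int.toNat_sub_toNat_neg _
    linear_combination -he + (k : ℤ) * this
  have hpow : ∀ q : ι →₀ ℕ, (monomial (k • q) 1 : MvPolynomial ι K) = monomial q 1 ^ k :=
    fun q => by rw [monomial_pow, one_pow]
  have hsplit : ∀ a q : ι →₀ ℕ, (monomial (a + q) 1 : MvPolynomial ι K) =
      monomial a 1 * monomial q 1 := fun a q => by rw [monomial_mul, one_mul]
  rw [hv, Ideal.mem_span_singleton]
  nth_rw 1 [hu]
  rw [hsplit, hsplit, hpow, hpow, ← mul_sub, binom, binomPlus_eq_monomial,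
    binomMinus_eq_monomial]
  exact (sub_dvd_pow_sub_pow _ _ k).mul_left _

theorem monomial_sub_mem_span_binom (c : ι → ℤ) (u v : ι →₀ ℕ) (k : ℤ)
    (h : ∀ e, (u e : ℤ) - v e = k * c e) :
    (monomial u 1 - monomial v 1 : MvPolynomial ι K) ∈ Ideal.span {binom K c} := by
  obtain ⟨j, rfl | rfl⟩ := k.eq_nat_or_neg
  · exact monomial_sub_mem_span_binom_of_nat c u v j h
  · rw [← neg_sub]
    exact neg_mem (monomial_sub_mem_span_binom_of_nat c v u j fun e => by
      linear_combination -h e)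

/-- If two monomials have the same image under a monomial map exactly when their exponents differ
by an integer multiple of `c ≠ 0`, then the binomial of `c` is primitive and generates the
kernel. -/
theorem isPrimitiveIn_and_ker_eq_span_binom (T : (ι →₀ ℕ) → (σ →₀ ℕ))
    (φ : MvPolynomial ι K →ₐ[K] MvPolynomial σ K)
    (hφ : ∀ u a, φ (monomial u a) = monomial (T u) a) (c : ι → ℤ) (hc : c ≠ 0)
    (hT : ∀ u v, T u = T v ↔ ∃ k : ℤ, ∀ e, (u e : ℤ) - v e = k * c e) :
    IsPrimitiveIn K (RingHom.ker φ.toRingHom) c ∧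
      RingHom.ker φ.toRingHom = Ideal.span {binom K c} := by
  have hmem : ∀ b : ι → ℤ, binom K b ∈ RingHom.ker φ.toRingHom ↔ ∃ k : ℤ, ∀ e, b e = k * c e := by
    intro b
    have h1 : binom K b ∈ RingHom.ker φ.toRingHom ↔ φ (binom K b) = 0 := Iff.rfl
    rw [h1, binom, binomPlus_eq_monomial, binomMinus_eq_monomial, map_sub, hφ, hφ, sub_eq_zero,
      (monomial_left_injective one_ne_zero).eq_iff, hT]
    simp only [Finsupp.coe_equivFunOnFinite_symm, Int.toNat_sub_toNat_neg]
  have hcmem : binom K c ∈ RingHom.ker φ.toRingHom := (hmem c).2 ⟨1, by simp⟩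
  refine ⟨⟨hc, hcmem, fun b hb hbI hplus hminus => ?_⟩, le_antisymm ?_ ?_⟩
  · obtain ⟨k, hk⟩ := (hmem b).1 hbI
    rw [binomPlus_eq_monomial, binomPlus_eq_monomial, monomial_dvd_monomial] at hplus
    rw [binomMinus_eq_monomial, binomMinus_eq_monomial, monomial_dvd_monomial] at hminus
    have hp : ∀ e, (b e).toNat ≤ (c e).toNat := hplus.1.resolve_left one_ne_zero
    have hm : ∀ e, (-b e).toNat ≤ (-c e).toNat := hminus.1.resolve_left one_ne_zero
    have hk0 : k ≠ 0 := by
      rintro rfl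
      exact hb (funext fun e => by simp [hk e])
    obtain ⟨e, he⟩ := Function.ne_iff.1 hc
    have hpe := hp e
    have hme := hm e
    have hke := hk e
    have hk1 : k = 1 := by
      rcases lt_or_gt_of_ne hk0 with hneg | hpos <;> rcases lt_or_gt_of_ne he with h0 | h0 <;>
        simp only [Pi.zero_apply] at h0
      · have : 0 < b e := hke ▸ mul_pos_of_neg_of_neg hneg h0
        omega
      · have : b e < 0 := hke ▸ mul_neg_of_neg_of_pos hneg h0
        omega
      · have : c e ≤ k * c e := by
          have : k * c e < 0 := mul_neg_of_pos_of_neg hpos h0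
          omega
        nlinarith
      · have : k * c e ≤ c e := by
          have : 0 < k * c e := mul_pos hpos h0
          omega
        nlinarith
    funext e
    simp [hk e, hk1]
  · exact ker_le_of_monomial_sub_mem T φ hφ _ fun u v huv => by
      obtain ⟨k, hk⟩ := (hT u v).1 huv
      exact monomial_sub_mem_span_binom c u v k hk
  · rwa [Ideal.span_singleton_le_iff_mem]

end MonomialMap

section IntegerKernel

/-- The signed maximal minors of a singular integer matrix of corank one, divided by their greatest
common divisor, generate its integer kernel. -/
theorem mulVec_eq_zero_iff_exists_mul_of_minors {n : ℕ} (A : Matrix (Fin (n + 1)) (Fin (n + 1)) ℤ)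
    (hdet : A.det = 0) (r : Fin (n + 1) → ℤ)
    (hr : ∀ i, r i = (A.submatrix Fin.succ (Fin.succAbove i)).det) (hr0 : r 0 ≠ 0)
    (d : ℕ) (hd : d = Finset.univ.gcd fun i => (r i).natAbs) (c : Fin (n + 1) → ℤ)
    (hc : ∀ i, c i = ((-1 : ℤ) ^ (i : ℕ) * r i) / (d : ℤ)) :
    c ≠ 0 ∧ ∀ b : Fin (n + 1) → ℤ, A.mulVec b = 0 ↔ ∃ k : ℤ, ∀ i, b i = k * c i := by
  have hd0 : (d : ℤ) ≠ 0 := by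
    rw [hd]
    intro h
    have := Finset.gcd_eq_zero_iff.1 (Int.natCast_eq_zero.1 h) 0 (Finset.mem_univ _)
    simp [hr0] at this
  have hdvd : ∀ i, (d : ℤ) ∣ r i := fun i => by
    rw [Int.natCast_dvd, hd]
    exact Finset.gcd_dvd (Finset.mem_univ i)
  have hdc : ∀ i, d * c i = (-1 : ℤ) ^ (i : ℕ) * r i := fun i => by
    rw [hc]
    exact Int.mul_ediv_cancel' ((hdvd i).mul_left _)
  have hadj : ∀ i, A.adjugate i 0 = d * c i := fun i => by
    rw [Matrix.adjugate_fin_succ_eq_det_submatrix, hdc, hr]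
    simp
  have hAc : A.mulVec c = 0 := by
    funext v
    have h : (A * A.adjugate) v 0 = 0 := by simp [Matrix.mul_adjugate, hdet]
    rw [Matrix.mul_apply] at h
    simp only [hadj] at h
    refine (mul_eq_zero.1 (?_ : (d : ℤ) * A.mulVec c v = 0)).resolve_left hd0
    rw [← h, Matrix.mulVec, dotProduct, Finset.mul_sum]
    exact Finset.sum_congr rfl fun _ _ => by ring
  have hc0 : c 0 ≠ 0 := fun h => by
    have := hdc 0
    simp [h, hr0.symm] at this
  have hzero : ∀ b : Fin (n + 1) → ℤ, A.mulVec b = 0 → b 0 = 0 → b = 0 := by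
    intro b hb hb0
    have htail : (fun i : Fin n => b i.succ) = 0 := by
      refine Matrix.eq_zero_of_mulVec_eq_zero (M := A.submatrix Fin.succ Fin.succ) ?_ ?_
      · simpa [hr] using hr0
      · funext v
        have := congrFun hb v.succ
        rw [Matrix.mulVec, dotProduct, Fin.sum_univ_succ, hb0] at this
        simpa [Matrix.mulVec, dotProduct] using this
    funext i
    exact Fin.cases hb0 (fun j => congrFun htail j) i
  have hgcd : ∀ x y : ℤ, (∀ i, x ∣ y * c i) → x ∣ y := by
    intro x y h
    have h1 : ∀ i, (x * d).natAbs ∣ y.natAbs * (r i).natAbs := fun i => by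
      rw [← Int.natAbs_mul, Int.natAbs_dvd_natAbs]
      have h2 : x * d ∣ y * ((-1) ^ (i : ℕ) * r i) := by
        rw [← hdc, mul_left_comm, mul_comm x]
        exact mul_dvd_mul_left _ (h i)
      have h3 : y * r i = (y * ((-1) ^ (i : ℕ) * r i)) * (-1) ^ (i : ℕ) := by
        have : ((-1 : ℤ) ^ (i : ℕ)) * (-1) ^ (i : ℕ) = 1 := by
          simp [← mul_pow]
        linear_combination -(y * r i) * this
      rw [h3]
      exact h2.mul_right _
    have h4 := Finset.dvd_gcd fun i (_ : i ∈ Finset.univ) => h1 i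
    rw [Finset.gcd_mul_left, ← hd, Int.natAbs_mul] at h4
    have h5 : 0 < d := Nat.pos_of_ne_zero (by exact_mod_cast hd0)
    exact Int.natAbs_dvd_natAbs.1 (Nat.dvd_of_mul_dvd_mul_right h5 (by simpa using h4))
  refine ⟨fun h => hc0 (congrFun h 0), fun b => ⟨fun hb => ?_, ?_⟩⟩
  · have h := hzero (c 0 • b - b 0 • c)
      (by rw [Matrix.mulVec_sub, Matrix.mulVec_smul, Matrix.mulVec_smul, hb, hAc]; simp)
      (by simp [mul_comm])
    have h' : ∀ i, c 0 * b i = b 0 * c i := fun i => by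
      simpa [sub_eq_zero] using congrFun h i
    obtain ⟨k, hk⟩ := hgcd (c 0) (b 0) fun i => ⟨b i, (h' i).symm⟩
    refine ⟨k, fun i => mul_left_cancel₀ hc0 ?_⟩
    rw [h', hk, mul_assoc]
  · rintro ⟨k, hk⟩
    have : b = k • c := funext fun i => by simp [hk i]
    rw [this, Matrix.mulVec_smul, hAc, smul_zero]

end IntegerKernel

/-- The incidence matrix of a weighted oriented cycle, with its first row and column deleted, is
triangular with nonzero diagonal. -/
theorem det_submatrix_succ_ne_zero_of_cycle {n : ℕ} (A : Matrix (Fin (n + 1)) (Fin (n + 1)) ℤ)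
    (hdiag : ∀ v, A v v ≠ 0) (hoff : ∀ v e, e ≠ v → e + 1 ≠ v → A v e = 0) :
    (A.submatrix Fin.succ Fin.succ).det ≠ 0 := by
  rw [Matrix.det_of_isLowerTriangular]
  · exact Finset.prod_ne_zero_iff.2 fun i _ => hdiag _
  · intro i j hij
    have hij' : i < j := hij
    refine hoff _ _ (fun h => hij'.ne' (Fin.succ_injective _ h)) fun h => ?_
    rw [Fin.ext_iff, Fin.val_add_one] at h
    have : (i : ℕ) < j := hij'
    split_ifs at h <;> simp at h
    omega

/-- Theorem 4.5. Let `C` be a balanced weighted oriented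
cycle on the `n + 1` vertices `v_0, …, v_n` (`n + 1` even) with the usual
labelling (edge `e_i` joins `v_i` and `v_{i+1}`, indices mod `n + 1`, with an
arbitrary orientation of each edge), with incidence matrix `A`. Then the toric
ideal `I_C` is generated by the primitive binomial `f_c`, where
`c_i = (-1)^i · M(A[0|i]) / d`, `M(A[0|i])` being the maximal minor of `A`
obtained by deleting the first row and the `i`-th column, and
`d = gcd_i M(A[0|i])`. -/
theorem stmt11 (K : Type*) [Field K] (n : ℕ) (hn : 2 ≤ n) (heven : Even (n + 1))
    (w : Fin (n + 1) → ℕ) (hw : ∀ v, 0 < w v) (orient : Fin (n + 1) → Bool)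
    (src tgt : Fin (n + 1) → Fin (n + 1))
    (hsrc : ∀ e, src e = if orient e then e else e + 1)
    (htgt : ∀ e, tgt e = if orient e then e + 1 else e)
    (I : Ideal (MvPolynomial (Fin (n + 1)) K))
    (hI : I = RingHom.ker (aeval (R := K)
      (fun e => X (src e) * X (tgt e) ^ w (tgt e)) :
        MvPolynomial (Fin (n + 1)) K →ₐ[K] MvPolynomial (Fin (n + 1)) K).toRingHom)
    (A : Matrix (Fin (n + 1)) (Fin (n + 1)) ℤ)
    (hA : ∀ v e, A v e =
      if src e = v then 1 else if tgt e = v then (w v : ℤ) else 0)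
    (hbal : A.det = 0)
    (r : Fin (n + 1) → ℤ)
    (hr : ∀ i, r i = (A.submatrix Fin.succ (Fin.succAbove i)).det)
    (d : ℕ) (hd : d = Finset.univ.gcd fun i => (r i).natAbs)
    (c : Fin (n + 1) → ℤ)
    (hc : ∀ i, c i = ((-1 : ℤ) ^ (i : ℕ) * r i) / (d : ℤ)) :
    IsPrimitiveIn K I c ∧ I = Ideal.span {binom K c} := by
  subst hI
  have hne : ∀ e : Fin (n + 1), e ≠ e + 1 := fun e h => by
    rw [Fin.ext_iff, Fin.val_add_one] at h
    split_ifs at h with hl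
    · simp [hl] at h
      omega
    · omega
  have hst : ∀ e, src e ≠ tgt e := fun e => by
    rw [hsrc, htgt]
    cases orient e
    · simpa using (hne e).symm
    · simpa using hne e
  have hpos : ∀ v e, src e = v ∨ tgt e = v → A v e ≠ 0 := fun v e h => by
    have := hw v
    rw [hA]
    split_ifs with h1 h2
    · exact one_ne_zero
    · exact_mod_cast this.ne'
    · tauto
  have hr0 : r 0 ≠ 0 := by
    rw [hr, Fin.succAbove_zero]
    refine det_submatrix_succ_ne_zero_of_cycle A (fun v => hpos v v ?_) fun v e h1 h2 => ?_
    · rw [hsrc, htgt]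
      cases orient v <;> simp
    · rw [hA, hsrc, htgt]
      cases orient e <;> simp [h1, h2]
  obtain ⟨hc0, hker⟩ := mulVec_eq_zero_iff_exists_mul_of_minors A hbal r hr hr0 d hd c hc
  let T : (Fin (n + 1) →₀ ℕ) → (Fin (n + 1) →₀ ℕ) := fun u =>
    ∑ e, u e • (Finsupp.single (src e) 1 + Finsupp.single (tgt e) (w (tgt e)))
  have hTA : ∀ u v, (T u v : ℤ) = ∑ e, A v e * u e := fun u v => by
    simp only [T, Finsupp.finsetSum_apply, Nat.cast_sum]
    refine Finset.sum_congr rfl fun e _ => ?_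
    rw [hA]
    by_cases h1 : src e = v
    · have h2 : tgt e ≠ v := fun h => hst e (h1.trans h.symm)
      simp [h1, h2]
    · by_cases h2 : tgt e = v
      · simp [h1, h2, mul_comm]
      · simp [h1, h2]
  refine isPrimitiveIn_and_ker_eq_span_binom T _ (fun u a => ?_) c hc0 fun u v => ?_
  · rw [aeval_monomial, Finsupp.prod_fintype _ _ (by simp), MvPolynomial.algebraMap_eq]
    have : ∀ e, (X (src e) * X (tgt e) ^ w (tgt e) : MvPolynomial (Fin (n + 1)) K) ^ u e =
        monomial (u e • (Finsupp.single (src e) 1 + Finsupp.single (tgt e) (w (tgt e)))) 1 :=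
      fun e => by
        rw [X_pow_eq_monomial, X, monomial_mul, monomial_pow, mul_one, one_pow]
    rw [Finset.prod_congr rfl fun e _ => this e, ← monomial_sum_one, C_mul_monomial, mul_one]
  · rw [← hker fun e => (u e : ℤ) - v e, Finsupp.ext_iff, funext_iff]
    refine forall_congr' fun x => ?_
    rw [← Nat.cast_inj (R := ℤ), hTA, hTA, ← sub_eq_zero, ← Finset.sum_sub_distrib]
    simp [Matrix.mulVec, dotProduct, mul_sub]
end

section
/- Let C_{2n} be a balanced weighted oriented cycle with the usual labelling and let f_x ∈ I_{C_{2n}} be a nonzero pure binomial with e_1 ∈ supp(f_x^+). Then for every 2 ≤ i ≤ 2n, e_i ∈ supp(f_x^+) if i is odd and e_i ∈ supp(f_x^-) if i is even; i.e., the vector x has the form x = ((−1)^{i+1} r_i)_{i=1}^{2n} with all r_i positive integers. -/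
open MvPolynomial Finset

/-- A binomial killed by a monomial substitution `e ↦ X ^ a e` has exponent vector orthogonal
to `a`. -/
theorem sum_mul_eq_zero_of_map_binom_eq_zero {K : Type*} [Field K] {ι : Type*} [Fintype ι]
    (φ : MvPolynomial ι K →ₐ[K] Polynomial K) (a : ι → ℕ)
    (hφ : ∀ e, φ (X e) = Polynomial.X ^ a e) (x : ι → ℤ) (hx : φ (binom K x) = 0) :
    ∑ e, (a e : ℤ) * x e = 0 := by
  have key : ∀ b : ι → ℕ, φ (∏ e, X e ^ b e) = Polynomial.X ^ (∑ e, a e * b e) := by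
    intro b
    simp only [map_prod, map_pow, hφ, ← pow_mul, Finset.prod_pow_eq_pow_sum]
  rw [binom, binomPlus, binomMinus, map_sub, key, key, sub_eq_zero] at hx
  have h := congrArg Polynomial.natDegree hx
  rw [Polynomial.natDegree_X_pow, Polynomial.natDegree_X_pow] at h
  have h' : ∑ e, (a e : ℤ) * ((x e).toNat : ℤ) = ∑ e, (a e : ℤ) * ((-x e).toNat : ℤ) := by
    exact_mod_cast h
  rw [← sub_eq_zero, ← Finset.sum_sub_distrib] at h'
  rw [← h']
  refine Finset.sum_congr rfl fun e _ => ?_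
  rw [← mul_sub, Int.toNat_sub_toNat_neg]

/-- A vanishing positive combination of two
integers forces opposite signs. -/
theorem opposite_signs_of_pos_combination {a b : ℕ} (ha : 0 < a) (hb : 0 < b) {s t : ℤ}
    (h : (a : ℤ) * s + b * t = 0) : (0 < s → t < 0) ∧ (s < 0 → 0 < t) := by
  have ha' : (0 : ℤ) < a := by exact_mod_cast ha
  have hb' : (0 : ℤ) < b := by exact_mod_cast hb
  constructor
  · intro hs
    by_contra! ht
    nlinarith [mul_pos ha' hs, mul_nonneg hb'.le ht]
  · intro hs
    by_contra! ht
    nlinarith [mul_neg_of_pos_of_neg ha' hs, mul_nonpos_of_nonneg_of_nonpos hb'.le ht]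

/-- from the proof of Theorem 4.5. Let `C` be a balanced
weighted oriented cycle on the `n + 1` vertices `v_0, …, v_n` (`n + 1` even)
with the usual labelling, and let `f_x ∈ I_C` be a nonzero pure binomial with
`e_0 ∈ supp(f_x⁺)` (i.e. `x 0 > 0`). Then the signs of `x` alternate along the
cycle: `x i > 0` for `i` even and `x i < 0` for `i` odd, i.e.
`x = ((-1)^i r_i)_i` with all `r_i` positive integers. -/
theorem stmt12 (K : Type*) [Field K] (n : ℕ) (hn : 2 ≤ n) (heven : Even (n + 1))
    (w : Fin (n + 1) → ℕ) (hw : ∀ v, 0 < w v) (orient : Fin (n + 1) → Bool)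
    (src tgt : Fin (n + 1) → Fin (n + 1))
    (hsrc : ∀ e, src e = if orient e then e else e + 1)
    (htgt : ∀ e, tgt e = if orient e then e + 1 else e)
    (I : Ideal (MvPolynomial (Fin (n + 1)) K))
    (hI : I = RingHom.ker (aeval (R := K)
      (fun e => X (src e) * X (tgt e) ^ w (tgt e)) :
        MvPolynomial (Fin (n + 1)) K →ₐ[K] MvPolynomial (Fin (n + 1)) K).toRingHom)
    (A : Matrix (Fin (n + 1)) (Fin (n + 1)) ℤ)
    (hA : ∀ v e, A v e =
      if src e = v then 1 else if tgt e = v then (w v : ℤ) else 0)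
    (hbal : A.det = 0)
    (x : Fin (n + 1) → ℤ) (hx : binom K x ∈ I) (hx0 : 0 < x 0) :
    ∀ i : Fin (n + 1),
      (Even (i : ℕ) → 0 < x i) ∧ (Odd (i : ℕ) → x i < 0) := by
  subst hI
  have hstep : ∀ i : Fin (n + 1), (0 < x i → x (i + 1) < 0) ∧ (x i < 0 → 0 < x (i + 1)) := by
    intro i
    let a : Fin (n + 1) → ℕ := fun e =>
      (if src e = i + 1 then 1 else 0) + (if tgt e = i + 1 then w (tgt e) else 0)
    let ψ : MvPolynomial (Fin (n + 1)) K →ₐ[K] Polynomial K :=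
      aeval fun u => if u = i + 1 then Polynomial.X else 1
    let φ : MvPolynomial (Fin (n + 1)) K →ₐ[K] MvPolynomial (Fin (n + 1)) K :=
      aeval fun e => X (src e) * X (tgt e) ^ w (tgt e)
    have hsum := sum_mul_eq_zero_of_map_binom_eq_zero (ψ.comp φ) a
      (fun e => by
        simp only [AlgHom.comp_apply, φ, ψ, aeval_X, map_mul, map_pow, a, pow_add]
        split_ifs <;> simp)
      x (by
        have h0 : φ (binom K x) = 0 := hx
        rw [AlgHom.comp_apply, h0, map_zero])
    have hne : i ≠ i + 1 := by
      have h1 : (1 : Fin (n + 1)) ≠ 0 := by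
        simp [Fin.ext_iff, Nat.mod_eq_of_lt (show 1 < n + 1 by omega)]
      simpa using h1
    rw [Finset.sum_eq_add i (i + 1) hne
      (fun e _ he => by
        have h1 : e + 1 ≠ i + 1 := fun h => he.1 (add_right_cancel h)
        have ha : a e = 0 := by
          simp only [a, hsrc, htgt]
          cases orient e <;> simp [he.1, he.2]
        simp [ha]) (by simp) (by simp)] at hsum
    refine opposite_signs_of_pos_combination ?_ ?_ hsum
    · simp only [a, hsrc, htgt]
      cases orient i <;> simp [hw]
    · simp only [a, hsrc, htgt]
      cases orient (i + 1) <;> simp [hw]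
  intro i
  induction i using Fin.induction with
  | zero => simpa using hx0
  | succ i ih =>
    have h := hstep i.castSucc
    rw [Fin.coeSucc_eq_succ] at h
    simp only [Fin.val_castSucc, Fin.val_succ, Nat.even_add_one, Nat.odd_add_one,
      Nat.not_even_iff_odd, Nat.not_odd_iff_even] at ih ⊢
    exact ⟨fun ho => h.2 (ih.2 ho), fun he => h.1 (ih.1 he)⟩
end
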